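/- arXiv:1509.07068 — 9 statements merged into one kernel-verified Lean document; each statement's English description precedes it below -/
import Mathlib

section
/- Let n ≥ 2 and 1 < p < ∞. There exist ε₀ > 0 and c ≥ 1 such that for every 0 < ε < ε₀ the function f : ℝⁿ → ℝ defined by f(η) = |η|ᵖ(1 + ε η₁/|η|) for η ≠ 0 and f(0) = 0 satisfies: (a) f(η) > 0 for all η ≠ 0; (b) f is positively homogeneous of degree p, i.e. f(rη) = rᵖ f(η) for r > 0, η ≠ 0; (c) f is twice continuously differentiable on ℝⁿ∖{0}; and (d) for every η with 1/2 < |η| < 1 and every ξ ∈ ℝⁿ, c⁻¹|ξ|² ≤ Σ_{j,k=1}^{n} (∂²f/∂η_j∂η_k)(η) ξ_j ξ_k ≤ c|ξ|². -/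
open scoped Classical

section NormPower

variable {E : Type*} [NormedAddCommGroup E] [InnerProductSpace ℝ E]

lemma hasFDerivAt_norm_rpow_of_ne_zero (q : ℝ) {x : E} (hx : x ≠ 0) :
    HasFDerivAt (fun y : E => ‖y‖ ^ q) ((q * ‖x‖ ^ (q - 2)) • innerSL ℝ x) x := by
  have hpos : 0 < ‖x‖ := norm_pos_iff.2 hx
  have h := (hasStrictFDerivAt_norm_sq x).hasFDerivAt.rpow_const (p := q / 2)
    (Or.inl (by positivity))
  have hsq (y : E) (s : ℝ) : (‖y‖ ^ 2) ^ s = ‖y‖ ^ (2 * s) := by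
    rw [← Real.rpow_natCast, ← Real.rpow_mul (norm_nonneg y)]
    norm_num
  simp only [hsq] at h
  convert h using 1
  · ext y
    congr 1
    ring
  · rw [show 2 * (q / 2 - 1) = q - 2 by ring]
    ext v
    simp
    ring

/-- The perturbed power `‖x‖ ^ p + ε ⟪e, x⟫ ‖x‖ ^ (p - 1)`. -/
noncomputable def perturbedPower (e : E) (ε p : ℝ) (x : E) : ℝ :=
  ‖x‖ ^ p + ε * (inner ℝ e x * ‖x‖ ^ (p - 1))

lemma contDiffAt_perturbedPower (e : E) (ε p : ℝ) {x : E} (hx : x ≠ 0) :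
    ContDiffAt ℝ 2 (perturbedPower e ε p) x := by
  have h (q : ℝ) : ContDiffAt ℝ 2 (fun y : E => ‖y‖ ^ q) x :=
    (contDiffAt_norm ℝ hx).rpow_const_of_ne (norm_ne_zero_iff.2 hx)
  have he : ContDiffAt ℝ 2 (fun y : E => inner ℝ e y) x :=
    (innerSL ℝ e).contDiff.contDiffAt
  exact (h p).add (contDiffAt_const.mul (he.mul (h (p - 1))))

lemma hasFDerivAt_perturbedPower (e : E) (ε p : ℝ) {x : E} (hx : x ≠ 0) :
    HasFDerivAt (perturbedPower e ε p)
      ((p * ‖x‖ ^ (p - 2)) • innerSL ℝ x +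
        ε • (inner ℝ e x • (((p - 1) * ‖x‖ ^ (p - 1 - 2)) • innerSL ℝ x) +
          ‖x‖ ^ (p - 1) • innerSL ℝ e)) x :=
  (hasFDerivAt_norm_rpow_of_ne_zero p hx).add
    (((innerSL ℝ e).hasFDerivAt.mul (hasFDerivAt_norm_rpow_of_ne_zero (p - 1) hx)).const_mul ε)

lemma iteratedFDeriv_two_perturbedPower (e : E) (ε p : ℝ) {x : E} (hx : x ≠ 0) (v : E) :
    iteratedFDeriv ℝ 2 (perturbedPower e ε p) x ![v, v] =
      ‖x‖ ^ (p - 2) * (p * (‖v‖ ^ 2 + (p - 2) * (inner ℝ x v / ‖x‖) ^ 2) +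
        ε * ((p - 1) * (2 * inner ℝ e v * (inner ℝ x v / ‖x‖) +
          inner ℝ e x / ‖x‖ * ‖v‖ ^ 2 +
          inner ℝ e x / ‖x‖ * (p - 3) * (inner ℝ x v / ‖x‖) ^ 2))) := by
  have hpos : 0 < ‖x‖ := norm_pos_iff.2 hx
  have hdiff : DifferentiableAt ℝ (fderiv ℝ (perturbedPower e ε p)) x :=
    ((contDiffAt_perturbedPower e ε p hx).fderiv_right (m := 1) (by norm_num)).differentiableAt
      (by norm_num)
  have hev : (fun y => fderiv ℝ (perturbedPower e ε p) y v) =ᶠ[nhds x] fun y =>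
      p * (‖y‖ ^ (p - 2) * inner ℝ v y) +
        ε * ((p - 1) * (inner ℝ e y * (‖y‖ ^ (p - 1 - 2) * inner ℝ v y)) +
          ‖y‖ ^ (p - 1) * inner ℝ e v) := by
    filter_upwards [isOpen_ne.mem_nhds hx] with y hy
    rw [(hasFDerivAt_perturbedPower e ε p hy).fderiv]
    simp [real_inner_comm]
    ring
  have hinner (w : E) : HasFDerivAt (fun y : E => inner ℝ w y) (innerSL ℝ w) x :=
    (innerSL ℝ w).hasFDerivAt
  have hpow (q : ℝ) := hasFDerivAt_norm_rpow_of_ne_zero q hx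
  have hd := ((((hpow (p - 2)).mul (hinner v)).const_mul p).add
    (((((hinner e).mul ((hpow (p - 1 - 2)).mul (hinner v))).const_mul (p - 1)).add
      ((hpow (p - 1)).mul_const (inner ℝ e v))).const_mul ε))
  have hleft := (hdiff.hasFDerivAt.clm_apply (hasFDerivAt_const v x))
  have heq := congrArg (fun L : E →L[ℝ] ℝ => L v)
    ((hleft.congr_of_eventuallyEq hev.symm).unique hd)
  rw [iteratedFDeriv_two_apply]
  have hshift (k : ℕ) : ‖x‖ ^ (p - 2 - k) = ‖x‖ ^ (p - 2) / ‖x‖ ^ k :=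
    Real.rpow_sub_natCast hpos.ne' _ _
  have h1 : ‖x‖ ^ (p - 1 - 2) = ‖x‖ ^ (p - 2) / ‖x‖ := by
    rw [← Real.rpow_sub_one hpos.ne']
    ring_nf
  have h2 : ‖x‖ ^ (p - 2 - 2) = ‖x‖ ^ (p - 2) / ‖x‖ ^ 2 := by
    rw [← hshift 2]
    norm_num
  have h3 : ‖x‖ ^ (p - 1 - 2 - 2) = ‖x‖ ^ (p - 2) / ‖x‖ ^ 3 := by
    rw [← hshift 3]
    norm_num
    ring_nf
  simp [h1, h2, h3, real_inner_comm x v] at heq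
  simp only [Matrix.cons_val_zero, Matrix.cons_val_one]
  rw [heq]
  field_simp
  ring

end NormPower

lemma convex_main_term_bounds {p w s : ℝ} (hp : 1 < p) (hs : s ^ 2 ≤ w) :
    p * min 1 (p - 1) * w ≤ p * (w + (p - 2) * s ^ 2) ∧
      p * (w + (p - 2) * s ^ 2) ≤ p ^ 2 * w := by
  have hs0 := sq_nonneg s
  constructor
  · rw [mul_assoc]
    refine mul_le_mul_of_nonneg_left ?_ (by linarith)
    rcases le_total 2 p with h | h
    · rw [min_eq_left (by linarith)]
      nlinarith
    · rw [min_eq_right (by linarith)]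
      nlinarith
  · rw [pow_two p, mul_assoc]
    refine mul_le_mul_of_nonneg_left ?_ (by linarith)
    nlinarith

lemma abs_perturbation_term_le {p a b s t : ℝ} (hp : 1 < p) (ha : |a| ≤ 1) (hb : |b| ≤ t)
    (hs : |s| ≤ t) :
    |(p - 1) * (2 * b * s + a * t ^ 2 + a * (p - 3) * s ^ 2)| ≤
      (p - 1) * (3 + |p - 3|) * t ^ 2 := by
  have ht : 0 ≤ t := (abs_nonneg b).trans hb
  rw [abs_mul, abs_of_pos (sub_pos.2 hp), mul_assoc _ (3 + _)]
  refine mul_le_mul_of_nonneg_left ?_ (by linarith)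
  have h1 : |2 * b * s| ≤ 2 * (t * t) := by
    rw [mul_assoc, abs_mul, abs_mul, abs_two]
    gcongr
  have h2 : |a * t ^ 2| ≤ 1 * t ^ 2 := by
    rw [abs_mul, abs_of_nonneg (sq_nonneg t)]
    gcongr
  have h3 : |a * (p - 3) * s ^ 2| ≤ 1 * |p - 3| * t ^ 2 := by
    rw [abs_mul, abs_mul, abs_pow]
    gcongr
  have h4 := abs_add_three (2 * b * s) (a * t ^ 2) (a * (p - 3) * s ^ 2)
  nlinarith

lemma rpow_bounds_of_half_lt {r : ℝ} (q : ℝ) (hr : 1 / 2 < r) (hr1 : r < 1) :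
    (2 ^ |q|)⁻¹ ≤ r ^ q ∧ r ^ q ≤ 2 ^ |q| := by
  have h0 : 0 < r := by linarith
  have hhalf : (2 ^ |q| : ℝ)⁻¹ = (1 / 2) ^ |q| := by
    rw [one_div, Real.inv_rpow (by norm_num)]
  have hlow : (2 ^ |q| : ℝ)⁻¹ ≤ r ^ |q| := by
    rw [hhalf]
    exact Real.rpow_le_rpow (by norm_num) hr.le (abs_nonneg q)
  refine ⟨hlow.trans (Real.rpow_le_rpow_of_exponent_ge h0 hr1.le (le_abs_self q)), ?_⟩
  have hup : r ^ q ≤ r ^ (-|q|) :=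
    Real.rpow_le_rpow_of_exponent_ge h0 hr1.le (neg_abs_le q)
  rw [Real.rpow_neg h0.le] at hup
  exact hup.trans (inv_le_of_inv_le₀ (by positivity) hlow)

lemma hessian_bounds_perturbedPower {E : Type*} [NormedAddCommGroup E] [InnerProductSpace ℝ E]
    {p : ℝ} (hp : 1 < p) : ∃ ε₀ : ℝ, 0 < ε₀ ∧ ε₀ ≤ 1 ∧ ∃ c : ℝ, 1 ≤ c ∧
      ∀ ε : ℝ, 0 < ε → ε < ε₀ → ∀ e : E, ‖e‖ ≤ 1 → ∀ x : E, 1 / 2 < ‖x‖ → ‖x‖ < 1 → ∀ v : E,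
        c⁻¹ * ‖v‖ ^ 2 ≤ iteratedFDeriv ℝ 2 (perturbedPower e ε p) x ![v, v] ∧
          iteratedFDeriv ℝ 2 (perturbedPower e ε p) x ![v, v] ≤ c * ‖v‖ ^ 2 := by
  set m := p * min 1 (p - 1) with hm
  set K := (p - 1) * (3 + |p - 3|) with hK
  set R : ℝ := 2 ^ |p - 2| with hR
  have hm0 : 0 < m := mul_pos (by linarith) (lt_min one_pos (by linarith))
  have hK0 : 0 < K := mul_pos (by linarith) (by positivity)
  have hR0 : 0 < R := by positivity
  have hmK : 0 < m / (2 * K) := by positivity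
  refine ⟨min 1 (m / (2 * K)), lt_min one_pos hmK, min_le_left _ _,
    1 + R * (2 / m) + R * (p ^ 2 + K), ?_, ?_⟩
  · have : 0 < R * (2 / m) := by positivity
    have : 0 < R * (p ^ 2 + K) := by positivity
    linarith
  intro ε hε hε₀ e he x hx hx1 v
  have hε1 : ε < 1 := hε₀.trans_le (min_le_left _ _)
  have hεK : ε * K ≤ m / 2 := by
    have := (lt_div_iff₀ (by positivity)).1 (hε₀.trans_le (min_le_right _ _))
    linarith
  have hpos : 0 < ‖x‖ := by linarith
  rw [iteratedFDeriv_two_perturbedPower e ε p (norm_pos_iff.1 hpos) v]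
  have ha : |inner ℝ e x / ‖x‖| ≤ 1 := by
    rw [abs_div, abs_norm, div_le_one hpos]
    exact (abs_real_inner_le_norm e x).trans (mul_le_of_le_one_left (norm_nonneg x) he)
  have hb : |inner ℝ e v| ≤ ‖v‖ :=
    (abs_real_inner_le_norm e v).trans (mul_le_of_le_one_left (norm_nonneg v) he)
  have hs : |inner ℝ x v / ‖x‖| ≤ ‖v‖ := by
    rw [abs_div, abs_norm, div_le_iff₀ hpos, mul_comm]
    exact abs_real_inner_le_norm x v
  have hpert := abs_le.1 (abs_perturbation_term_le hp ha hb hs)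
  have hmain := convex_main_term_bounds hp (sq_le_sq.2 (hs.trans (le_abs_self _)))
  obtain ⟨hrl, hru⟩ := rpow_bounds_of_half_lt (p - 2) hx hx1
  rw [← hK] at hpert
  rw [← hm] at hmain
  rw [← hR] at hrl hru
  set P := p * (‖v‖ ^ 2 + (p - 2) * (inner ℝ x v / ‖x‖) ^ 2)
  set T := (p - 1) * (2 * inner ℝ e v * (inner ℝ x v / ‖x‖) + inner ℝ e x / ‖x‖ * ‖v‖ ^ 2 +
    inner ℝ e x / ‖x‖ * (p - 3) * (inner ℝ x v / ‖x‖) ^ 2)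
  have hv : 0 ≤ ‖v‖ ^ 2 := sq_nonneg _
  have hlow : m / 2 * ‖v‖ ^ 2 ≤ P + ε * T := by
    have h1 := mul_le_mul_of_nonneg_left hpert.1 hε.le
    have h2 := mul_le_mul_of_nonneg_right hεK hv
    linarith
  have hup : P + ε * T ≤ (p ^ 2 + K) * ‖v‖ ^ 2 := by
    have h1 := mul_le_mul_of_nonneg_left hpert.2 hε.le
    have h2 := mul_le_mul_of_nonneg_right hε1.le (mul_nonneg hK0.le hv)
    linarith
  constructor
  · calc _ ≤ (R * (2 / m))⁻¹ * ‖v‖ ^ 2 := by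
          gcongr
          have : 0 < R * (p ^ 2 + K) := by positivity
          linarith
      _ = R⁻¹ * (m / 2 * ‖v‖ ^ 2) := by
          field_simp
      _ ≤ _ := by gcongr
  · calc _ ≤ R * ((p ^ 2 + K) * ‖v‖ ^ 2) :=
          mul_le_mul hru hup (le_trans (by positivity) hlow) hR0.le
      _ = R * (p ^ 2 + K) * ‖v‖ ^ 2 := by ring
      _ ≤ _ := by
          gcongr
          have : 0 < R * (2 / m) := by positivity
          linarith

/-- For `n ≥ 2` and `1 < p < ∞` there exist `ε₀ > 0` and `c ≥ 1` such that for all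
`0 < ε < ε₀` the function `f(η) = |η|ᵖ (1 + ε η₁ / |η|)`, `f(0) = 0`, is positive away
from the origin, positively homogeneous of degree `p`, `C²` away from the origin, and
uniformly convex on the annulus `1/2 < |η| < 1`. -/
theorem perturbed_power_satisfies_structure
    (n : ℕ) (hn : 2 ≤ n) (p : ℝ) (hp : 1 < p) :
    ∃ ε₀ : ℝ, 0 < ε₀ ∧ ∃ c : ℝ, 1 ≤ c ∧
      ∀ ε : ℝ, 0 < ε → ε < ε₀ →
        ∀ f : EuclideanSpace ℝ (Fin n) → ℝ,
          (f = fun η => if η = 0 then 0 else ‖η‖ ^ p * (1 + ε * η ⟨0, by omega⟩ / ‖η‖)) →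
          (∀ η : EuclideanSpace ℝ (Fin n), η ≠ 0 → 0 < f η) ∧
          (∀ r : ℝ, 0 < r → ∀ η : EuclideanSpace ℝ (Fin n), η ≠ 0 →
            f (r • η) = r ^ p * f η) ∧
          ContDiffOn ℝ 2 f ({0} : Set (EuclideanSpace ℝ (Fin n)))ᶜ ∧
          (∀ η : EuclideanSpace ℝ (Fin n), 1 / 2 < ‖η‖ → ‖η‖ < 1 →
            ∀ ξ : EuclideanSpace ℝ (Fin n),
              c⁻¹ * ‖ξ‖ ^ 2 ≤ iteratedFDeriv ℝ 2 f η ![ξ, ξ] ∧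
              iteratedFDeriv ℝ 2 f η ![ξ, ξ] ≤ c * ‖ξ‖ ^ 2) := by
  set e : EuclideanSpace ℝ (Fin n) := EuclideanSpace.single ⟨0, by omega⟩ 1 with he_def
  have he : ‖e‖ ≤ 1 := by simp [he_def]
  have hcoord (x : EuclideanSpace ℝ (Fin n)) : inner ℝ e x = x ⟨0, by omega⟩ := by
    simp [he_def, EuclideanSpace.inner_single_left]
  obtain ⟨ε₀, hε₀, hε₀1, c, hc, hbounds⟩ :=
    hessian_bounds_perturbedPower (E := EuclideanSpace ℝ (Fin n)) hp
  refine ⟨ε₀, hε₀, c, hc, ?_⟩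
  intro ε hε hεlt f hf
  have hval {x : EuclideanSpace ℝ (Fin n)} (hx : x ≠ 0) :
      f x = ‖x‖ ^ p * (1 + ε * x ⟨0, by omega⟩ / ‖x‖) := by
    simp [hf, hx]
  have hfeq {x : EuclideanSpace ℝ (Fin n)} (hx : x ≠ 0) :
      f x = perturbedPower e ε p x := by
    have hpos : 0 < ‖x‖ := norm_pos_iff.2 hx
    rw [hval hx, perturbedPower, hcoord, Real.rpow_sub_one hpos.ne']
    ring
  have hev {x : EuclideanSpace ℝ (Fin n)} (hx : x ≠ 0) :
      f =ᶠ[nhds x] perturbedPower e ε p := by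
    filter_upwards [isOpen_ne.mem_nhds hx] with y hy using hfeq hy
  refine ⟨?_, ?_, ?_, ?_⟩
  · intro x hx
    have hpos : 0 < ‖x‖ := norm_pos_iff.2 hx
    have habs : |x ⟨0, by omega⟩| ≤ ‖x‖ := PiLp.norm_apply_le x ⟨0, by omega⟩
    rw [hval hx]
    refine mul_pos (by positivity) ?_
    have h1 : -1 < ε * x ⟨0, by omega⟩ / ‖x‖ := by
      rw [lt_div_iff₀ hpos]
      have := mul_le_mul_of_nonneg_left (abs_le.1 habs).1 hε.le
      nlinarith
    linarith
  · intro r hr x hx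
    have hpos : 0 < ‖x‖ := norm_pos_iff.2 hx
    rw [hval hx, hval (smul_ne_zero hr.ne' hx), norm_smul, Real.norm_of_nonneg hr.le,
      Real.mul_rpow hr.le hpos.le, PiLp.smul_apply, smul_eq_mul]
    field_simp
  · intro x hx
    exact ((contDiffAt_perturbedPower e ε p hx).congr_of_eventuallyEq
      (hev hx)).contDiffWithinAt
  · intro x hx hx1 v
    have hx0 : x ≠ 0 := norm_pos_iff.1 (by linarith)
    rw [((hev hx0).iteratedFDeriv ℝ 2).eq_of_nhds]
    exact hbounds ε hε hεlt e he x hx hx1 v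
end

section
/- Let n ≥ 2 and p ≥ n be real, let A and B be real n×n symmetric matrices with B positive definite and tr(BA) = 0. Then tr((BA)²) ≥ 0, and for every nonzero row vector ζ ∈ ℝⁿ, tr((BA)²) − (p/(p−1))·(ζ(BABAB)ζᵀ)/(ζBζᵀ) ≥ ((p−n)/(n(n−1)(p−1)))·tr((BA)²) ≥ 0. -/
open Matrix

open scoped MatrixOrder in
/-- A positive semidefinite form and a symmetric matrix can be diagonalized simultaneously. -/
theorem exists_transpose_mul_self_and_diagonal {n : ℕ} {A B : Matrix (Fin n) (Fin n) ℝ}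
    (hA : A.IsSymm) (hB : B.PosSemidef) :
    ∃ (Q : Matrix (Fin n) (Fin n) ℝ) (d : Fin n → ℝ),
      B = Qᵀ * Q ∧ Q * A * Qᵀ = diagonal d := by
  obtain ⟨C, hC⟩ : ∃ C : Matrix (Fin n) (Fin n) ℝ, B = Cᵀ * C := by
    obtain ⟨C, hC⟩ := CStarAlgebra.nonneg_iff_eq_star_mul_self.mp hB.nonneg
    exact ⟨C, by simpa [star_eq_conjTranspose, conjTranspose_eq_transpose_of_trivial] using hC⟩
  have hE : (C * A * Cᵀ).IsHermitian := by
    rw [IsHermitian, conjTranspose_eq_transpose_of_trivial, transpose_mul, transpose_mul,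
      transpose_transpose, hA.eq, Matrix.mul_assoc]
  set U : Matrix (Fin n) (Fin n) ℝ := hE.eigenvectorUnitary.1
  have hUU : U * Uᵀ = 1 := by
    simpa [star_eq_conjTranspose, conjTranspose_eq_transpose_of_trivial] using
      Unitary.coe_mul_star_self hE.eigenvectorUnitary
  have hUU' : Uᵀ * U = 1 := mul_eq_one_comm.mp hUU
  have hspec : C * A * Cᵀ = U * diagonal hE.eigenvalues * Uᵀ := by
    have h := hE.spectral_theorem
    rw [Unitary.conjStarAlgAut_apply] at h
    simpa [star_eq_conjTranspose, conjTranspose_eq_transpose_of_trivial] using h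
  refine ⟨Uᵀ * C, hE.eigenvalues, ?_, ?_⟩
  · calc B = Cᵀ * (U * Uᵀ) * C := by rw [hUU, Matrix.mul_one, hC]
      _ = _ := by simp only [transpose_mul, transpose_transpose, Matrix.mul_assoc]
  · calc Uᵀ * C * A * (Uᵀ * C)ᵀ = Uᵀ * (C * A * Cᵀ) * U := by
          simp only [transpose_mul, transpose_transpose, Matrix.mul_assoc]
      _ = (Uᵀ * U) * diagonal hE.eigenvalues * (Uᵀ * U) := by
          simp only [hspec, Matrix.mul_assoc]
      _ = _ := by rw [hUU', Matrix.one_mul, Matrix.mul_one]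

/-- If finitely many reals sum to zero, the square of each is at most `(n - 1) / n` times
the sum of all squares. -/
theorem card_mul_sq_le_of_sum_eq_zero {n : ℕ} {d : Fin n → ℝ} (hd : ∑ i, d i = 0)
    (i : Fin n) : n * d i ^ 2 ≤ (n - 1) * ∑ j, d j ^ 2 := by
  have h1 : d i + ∑ j ∈ Finset.univ.erase i, d j = 0 := by
    rw [Finset.add_sum_erase _ _ (Finset.mem_univ i), hd]
  have h2 := Finset.add_sum_erase Finset.univ (fun j => d j ^ 2) (Finset.mem_univ i)
  have h3 := sq_sum_le_card_mul_sum_sq (s := Finset.univ.erase i) (f := d)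
  rw [Finset.card_erase_of_mem (Finset.mem_univ i), Finset.card_univ, Fintype.card_fin,
    Nat.cast_pred (Fin.pos i), eq_neg_of_add_eq_zero_right h1, neg_sq] at h3
  rw [← h2]
  linarith

/-- For `n ≥ 2`, `p ≥ n`, symmetric `A`, positive definite symmetric `B` with
`tr(BA) = 0`: `tr((BA)²) ≥ 0` and for every nonzero row vector `ζ`,
`tr((BA)²) - (p/(p-1)) ζ(BABAB)ζᵀ/(ζBζᵀ) ≥ ((p-n)/(n(n-1)(p-1))) tr((BA)²) ≥ 0`. -/
theorem trace_BA_sq_lower_bound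
    (n : ℕ) (hn : 2 ≤ n) (p : ℝ) (hp : (n : ℝ) ≤ p)
    (A B : Matrix (Fin n) (Fin n) ℝ)
    (hA : A.IsSymm) (hB : B.IsSymm) (hBpd : B.PosDef)
    (htr : (B * A).trace = 0) :
    0 ≤ ((B * A) ^ 2).trace ∧
    ∀ ζ : Fin n → ℝ, ζ ≠ 0 →
      ((p - n) / ((n : ℝ) * ((n : ℝ) - 1) * (p - 1))) * ((B * A) ^ 2).trace ≤
        ((B * A) ^ 2).trace -
          (p / (p - 1)) * ((ζ ⬝ᵥ ((B * A * B * A * B) *ᵥ ζ)) / (ζ ⬝ᵥ (B *ᵥ ζ))) ∧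
      0 ≤ ((p - n) / ((n : ℝ) * ((n : ℝ) - 1) * (p - 1))) * ((B * A) ^ 2).trace := by
  obtain ⟨Q, d, rfl, hQ⟩ := exists_transpose_mul_self_and_diagonal hA hBpd.posSemidef
  have hd : ∑ i, d i = 0 := by
    rw [← trace_diagonal, ← hQ, ← htr, trace_mul_comm, ← Matrix.mul_assoc]
  have hT : ((Qᵀ * Q * A) ^ 2).trace = ∑ i, d i ^ 2 := by
    calc ((Qᵀ * Q * A) ^ 2).trace = (Qᵀ * (Q * A * Qᵀ * Q * A)).trace := by
          simp only [pow_two, Matrix.mul_assoc]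
      _ = ((Q * A * Qᵀ) * (Q * A * Qᵀ)).trace := by
          rw [trace_mul_comm]; simp only [Matrix.mul_assoc]
      _ = _ := by rw [hQ, diagonal_mul_diagonal, trace_diagonal]; simp only [pow_two]
  have hT0 : 0 ≤ ∑ i, d i ^ 2 := Finset.sum_nonneg fun i _ => sq_nonneg _
  have hn' : (2 : ℝ) ≤ n := by exact_mod_cast hn
  have hn1 : (0 : ℝ) < n - 1 := by linarith
  have hp1 : 0 < p - 1 := by linarith
  have hpn : 0 ≤ p - n := by linarith
  rw [hT]
  refine ⟨hT0, fun ζ hζ => ⟨?_, by positivity⟩⟩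
  have hpos : 0 < ζ ⬝ᵥ ((Qᵀ * Q) *ᵥ ζ) := by
    simpa using hBpd.dotProduct_mulVec_pos hζ
  have hden : ζ ⬝ᵥ ((Qᵀ * Q) *ᵥ ζ) = ∑ i, (Q *ᵥ ζ) i ^ 2 := by
    rw [← mulVec_mulVec, dotProduct_mulVec, vecMul_transpose]
    simp only [dotProduct, pow_two]
  have hnum : ζ ⬝ᵥ ((Qᵀ * Q * A * (Qᵀ * Q) * A * (Qᵀ * Q)) *ᵥ ζ) =
      ∑ i, d i ^ 2 * (Q *ᵥ ζ) i ^ 2 := by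
    have h : Qᵀ * Q * A * (Qᵀ * Q) * A * (Qᵀ * Q) =
        Qᵀ * ((Q * A * Qᵀ) * (Q * A * Qᵀ) * Q) := by
      simp only [Matrix.mul_assoc]
    rw [h, hQ, diagonal_mul_diagonal, ← mulVec_mulVec, ← mulVec_mulVec, dotProduct_mulVec,
      vecMul_transpose]
    simp only [dotProduct, mulVec_diagonal]
    exact Finset.sum_congr rfl fun i _ => by ring
  have hratio : ζ ⬝ᵥ ((Qᵀ * Q * A * (Qᵀ * Q) * A * (Qᵀ * Q)) *ᵥ ζ) / (ζ ⬝ᵥ ((Qᵀ * Q) *ᵥ ζ)) ≤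
      (n - 1) / n * ∑ i, d i ^ 2 := by
    rw [div_le_iff₀ hpos, hnum, hden, Finset.mul_sum]
    refine Finset.sum_le_sum fun i _ => mul_le_mul_of_nonneg_right ?_ (sq_nonneg _)
    rw [div_mul_eq_mul_div, le_div_iff₀ (by linarith), mul_comm]
    exact card_mul_sq_le_of_sum_eq_zero hd i
  have hcoef : (p - n) / (n * (n - 1) * (p - 1)) ≤ 1 - p / (p - 1) * ((n - 1) / n) := by
    have h : 1 - p / (p - 1) * ((n - 1) / n) = (p - n) / (n * (p - 1)) := by
      field_simp
      ring
    rw [h]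
    refine div_le_div_of_nonneg_left hpn (by positivity) ?_
    refine mul_le_mul_of_nonneg_right ?_ hp1.le
    nlinarith
  have h1 := mul_le_mul_of_nonneg_right hcoef hT0
  have h2 := mul_le_mul_of_nonneg_left hratio (show 0 ≤ p / (p - 1) by
    exact div_nonneg (by linarith) hp1.le)
  linarith
end

section
/- Let n ≥ 3, let E be a nonzero real n×n symmetric matrix with tr(E) = 0, and let y ∈ ℝⁿ be a nonzero row vector satisfying tr(E²)·(yyᵀ) = (n/(n−1))·(yE²yᵀ). Then y is an eigenvector of E, i.e. there exists 𝒱 ∈ ℝ with yE = 𝒱y. -/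
open Matrix

/-- For a family of `n` reals with zero sum, the sum of squares exceeds `n / (n - 1)` times any
single square by an explicit sum of squares. -/
theorem sum_sq_sub_eq_sum_erase {n : ℕ} (hn : 2 ≤ n) (d : Fin n → ℝ) (hd : ∑ j, d j = 0)
    (i : Fin n) :
    ∑ j, d j ^ 2 - (n : ℝ) / ((n : ℝ) - 1) * d i ^ 2 =
      ∑ j ∈ Finset.univ.erase i, (d j + d i / ((n : ℝ) - 1)) ^ 2 := by
  have hn' : (2 : ℝ) ≤ n := by exact_mod_cast hn
  have hne : (n : ℝ) - 1 ≠ 0 := by linarith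
  have h := Finset.sum_erase_add Finset.univ (fun j => (d j + d i / ((n : ℝ) - 1)) ^ 2)
    (Finset.mem_univ i)
  have hfull : ∑ j, (d j + d i / ((n : ℝ) - 1)) ^ 2 =
      ∑ j, d j ^ 2 + n * (d i / ((n : ℝ) - 1)) ^ 2 := by
    simp only [add_sq, Finset.sum_add_distrib, ← Finset.sum_mul, ← Finset.mul_sum, hd]
    simp
  rw [hfull] at h
  rw [eq_sub_of_add_eq h]
  field_simp
  ring

/-- The equality case for diagonal matrices. -/
theorem exists_mul_eq_of_sum_sq_eq {n : ℕ} (hn : 3 ≤ n) (d z : Fin n → ℝ) (hd : ∑ j, d j = 0)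
    (h : (∑ j, d j ^ 2) * ∑ i, z i ^ 2 = (n : ℝ) / ((n : ℝ) - 1) * ∑ i, d i ^ 2 * z i ^ 2) :
    ∃ V : ℝ, ∀ i, d i * z i = V * z i := by
  have hn' : (3 : ℝ) ≤ n := by exact_mod_cast hn
  have hne : (n : ℝ) - 1 ≠ 0 := by linarith
  have hgap := sum_sq_sub_eq_sum_erase (by omega) d hd
  have hzero : ∑ i, (∑ j, d j ^ 2 - (n : ℝ) / ((n : ℝ) - 1) * d i ^ 2) * z i ^ 2 = 0 := by
    simp only [sub_mul, Finset.sum_sub_distrib, ← Finset.mul_sum, mul_assoc]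
    linarith
  have hterm := (Finset.sum_eq_zero_iff_of_nonneg fun i _ => by
    rw [hgap i]; positivity).1 hzero
  have hother (i j : Fin n) (hi : z i ≠ 0) (hji : j ≠ i) : d j * ((n : ℝ) - 1) = -d i := by
    have hs := (mul_eq_zero.1 (hterm i (Finset.mem_univ i))).resolve_right (pow_ne_zero 2 hi)
    rw [hgap i] at hs
    have hj := (Finset.sum_eq_zero_iff_of_nonneg fun j _ => sq_nonneg _).1 hs j
      (Finset.mem_erase.2 ⟨hji, Finset.mem_univ j⟩)
    have hj' := pow_eq_zero_iff two_ne_zero |>.1 hj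
    field_simp at hj'
    linarith
  by_cases hz : ∃ i, z i ≠ 0
  · obtain ⟨i, hi⟩ := hz
    refine ⟨d i, fun j => ?_⟩
    by_cases hj : z j = 0
    · simp [hj]
    by_cases hji : j = i
    · rw [hji]
    have h₁ := hother i j hi hji
    have h₂ := hother j i hj (Ne.symm hji)
    have h₃ : (d j - d i) * ((n : ℝ) - 2) = 0 := by linear_combination h₁ - h₂
    rw [sub_eq_zero.1 ((mul_eq_zero.1 h₃).resolve_right (by linarith))]
  · push Not at hz
    exact ⟨0, fun i => by simp [hz i]⟩

/-- A real symmetric matrix is orthogonally diagonalizable. -/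
theorem Matrix.IsSymm.exists_orthogonal_diagonal {n : ℕ} {E : Matrix (Fin n) (Fin n) ℝ}
    (hE : E.IsSymm) :
    ∃ (U : Matrix (Fin n) (Fin n) ℝ) (d : Fin n → ℝ),
      Uᵀ * U = 1 ∧ U * Uᵀ = 1 ∧ E = U * diagonal d * Uᵀ := by
  have hH : E.IsHermitian := by rwa [IsHermitian, conjTranspose_eq_transpose_of_trivial]
  refine ⟨hH.eigenvectorUnitary, hH.eigenvalues, ?_, ?_, ?_⟩
  · simpa [star_eq_conjTranspose] using Unitary.coe_star_mul_self hH.eigenvectorUnitary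
  · simpa [star_eq_conjTranspose] using Unitary.coe_mul_star_self hH.eigenvectorUnitary
  · simpa [Unitary.conjStarAlgAut_apply, star_eq_conjTranspose, Function.comp_def]
      using hH.spectral_theorem

/-- If `E` is a nonzero symmetric trace-free `n × n` matrix, `n ≥ 3`, and the nonzero
row vector `y` satisfies `tr(E²) (yyᵀ) = (n/(n-1)) (yE²yᵀ)`, then `y` is an
eigenvector of `E`. -/
theorem eigenvector_of_equality_case
    (n : ℕ) (hn : 3 ≤ n)
    (E : Matrix (Fin n) (Fin n) ℝ)
    (hE : E.IsSymm) (hE0 : E ≠ 0) (htr : E.trace = 0)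
    (y : Fin n → ℝ) (hy : y ≠ 0)
    (heq : (E ^ 2).trace * (y ⬝ᵥ y) = ((n : ℝ) / ((n : ℝ) - 1)) * (y ⬝ᵥ ((E ^ 2) *ᵥ y))) :
    ∃ V : ℝ, y ᵥ* E = V • y := by
  obtain ⟨U, d, hU, hU', rfl⟩ := hE.exists_orthogonal_diagonal
  have hsq : (U * diagonal d * Uᵀ) ^ 2 = U * diagonal (fun i => d i ^ 2) * Uᵀ := by
    calc (U * diagonal d * Uᵀ) ^ 2 = U * diagonal d * (Uᵀ * U) * diagonal d * Uᵀ := by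
          simp only [sq, Matrix.mul_assoc]
      _ = U * diagonal (fun i => d i ^ 2) * Uᵀ := by
          rw [hU, Matrix.mul_one, Matrix.mul_assoc U, diagonal_mul_diagonal]
          simp only [sq]
  have htrace (e : Fin n → ℝ) : (U * diagonal e * Uᵀ).trace = ∑ i, e i := by
    rw [trace_mul_comm, ← Matrix.mul_assoc, hU, Matrix.one_mul, trace_diagonal]
  have hquad (e : Fin n → ℝ) :
      y ⬝ᵥ ((U * diagonal e * Uᵀ) *ᵥ y) = ∑ i, e i * (y ᵥ* U) i ^ 2 := by
    rw [← mulVec_mulVec, ← mulVec_mulVec, dotProduct_mulVec, mulVec_transpose]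
    simp only [dotProduct, mulVec_diagonal]
    exact Finset.sum_congr rfl fun i _ => by ring
  have hnorm : y ⬝ᵥ y = ∑ i, (y ᵥ* U) i ^ 2 := by
    simpa [hU'] using hquad 1
  rw [hsq, htrace, hquad, hnorm] at heq
  rw [htrace] at htr
  obtain ⟨V, hV⟩ := exists_mul_eq_of_sum_sq_eq hn d (y ᵥ* U) htr heq
  refine ⟨V, ?_⟩
  have hdiag : (y ᵥ* U) ᵥ* diagonal d = V • (y ᵥ* U) := by
    ext i
    rw [vecMul_diagonal, mul_comm, hV, Pi.smul_apply, smul_eq_mul]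
  rw [← vecMul_vecMul, ← vecMul_vecMul, hdiag, smul_vecMul, vecMul_vecMul, hU', vecMul_one]
end

section
/- Let n ≥ 1, λ ≥ 0, and let A and B be real n×n symmetric matrices such that B − λI is positive semidefinite. Then tr((AB)²) ≥ λ²·tr(A²). -/
open Matrix

open scoped MatrixOrder in
theorem Matrix.PosSemidef.trace_mul_nonneg {m : Type*} [Fintype m]
    {M N : Matrix m m ℝ} (hM : M.PosSemidef) (hN : N.PosSemidef) : 0 ≤ (M * N).trace := by
  classical
  obtain ⟨S, rfl⟩ := CStarAlgebra.nonneg_iff_eq_star_mul_self.mp hN.nonneg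
  rw [star_eq_conjTranspose]
  rw [← mul_assoc, trace_mul_comm, ← mul_assoc]
  exact (hM.mul_mul_conjTranspose_same S).trace_nonneg

/-- If `A`, `B` are symmetric and `B - λI` is positive semidefinite with `λ ≥ 0`,
then `tr((AB)²) ≥ λ² tr(A²)`. -/
theorem trace_AB_sq_ge
    (n : ℕ) (hn : 1 ≤ n) (lam : ℝ) (hlam : 0 ≤ lam)
    (A B : Matrix (Fin n) (Fin n) ℝ)
    (hA : A.IsSymm) (hB : B.IsSymm)
    (hpsd : (B - lam • (1 : Matrix (Fin n) (Fin n) ℝ)).PosSemidef) :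
    lam ^ 2 * (A ^ 2).trace ≤ ((A * B) ^ 2).trace := by
  obtain ⟨C, rfl⟩ : ∃ C, B = C + lam • (1 : Matrix (Fin n) (Fin n) ℝ) := ⟨_, (sub_add_cancel B _).symm⟩
  rw [add_sub_cancel_right] at hpsd
  have hACA : (A * C * A).PosSemidef := by
    simpa [conjTranspose_eq_transpose_of_trivial, hA.eq] using
      hpsd.mul_mul_conjTranspose_same A
  have h₁ : 0 ≤ (A * C * A).trace := hACA.trace_nonneg
  have h₂ : 0 ≤ (A * C * A * C).trace := hACA.trace_mul_nonneg hpsd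
  have h₃ : (A * A * C).trace = (A * C * A).trace := by
    rw [trace_mul_comm (A * C), mul_assoc]
  have expand : ((A * (C + lam • 1)) ^ 2).trace =
      (A * C * A * C).trace + 2 * lam * (A * C * A).trace + lam ^ 2 * (A ^ 2).trace := by
    simp only [sq, mul_add, add_mul, mul_smul_comm, smul_mul_assoc, mul_one, trace_add, trace_smul,
      smul_eq_mul, ← mul_assoc, h₃]
    ring
  rw [expand]
  nlinarith [mul_nonneg hlam h₁]
end

section
/- Let n ≥ 1 and let μ be a locally finite Borel measure on ℝⁿ. For every constant c > 2·100^{n+1}, the set Θ = {x ∈ ℝⁿ : μ(B(x,t)) > 0 for all t > 0, and liminf_{t→0⁺} μ(B(x,100t))/μ(B(x,t)) ≥ c} satisfies μ(Θ) = 0. Consequently, for μ-almost every w with μ(B(w,t)) > 0 for all t > 0, there exist arbitrarily small radii r > 0 with μ(B(w,100r)) ≤ c·μ(B(w,r)). -/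
open MeasureTheory Metric Filter Topology

/-- If balls around `x` grow in `μ`-measure by a factor `100 ^ (n + 1)` when dilated by `100`, at all
small scales, then the ratio of the volume to `μ` on closed balls around `x` is unbounded. -/
theorem eq_top_of_tendsto_volume_div_of_ball_growth {n : ℕ}
    {μ : Measure (EuclideanSpace ℝ (Fin n))} [IsLocallyFiniteMeasure μ]
    {x : EuclideanSpace ℝ (Fin n)} (hpos : ∀ t : ℝ, 0 < t → 0 < μ (ball x t))
    {t₀ : ℝ} (ht₀ : 0 < t₀)
    (hgrow : ∀ t : ℝ, 0 < t → t < t₀ → 100 ^ (n + 1) * μ (ball x t) ≤ μ (ball x (100 * t)))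
    {L : ENNReal}
    (hL : Tendsto (fun r : ℝ => volume (closedBall x r) / μ (closedBall x r)) (𝓝[>] 0) (𝓝 L)) :
    L = ⊤ := by
  set s : ℝ := t₀ / 2 with hs
  have hs0 : 0 < s := by positivity
  set r : ℕ → ℝ := fun k => s / 100 ^ k with hr
  have hr0 : ∀ k, 0 < r k := fun k => by simp only [hr]; positivity
  have hrs : ∀ k, r k ≤ s := fun k =>
    div_le_self hs0.le (one_le_pow₀ (by norm_num))
  have hdecay : ∀ k, (100 ^ (n + 1)) ^ k * μ (ball x (r k)) ≤ μ (ball x s) := by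
    intro k
    induction k with
    | zero => simp [hr]
    | succ k ih =>
      refine le_trans ?_ ih
      rw [pow_succ, mul_assoc]
      gcongr
      have h := hgrow (r (k + 1)) (hr0 _) (by have := hrs (k + 1); linarith)
      have h2 : 100 * r (k + 1) = r k := by
        simp only [hr, pow_succ]; field_simp
      rwa [h2] at h
  set M := μ (ball x s)
  have hM0 : M ≠ 0 := (hpos s hs0).ne'
  have hMtop : M ≠ ⊤ := measure_ball_lt_top.ne
  set V := volume (closedBall x (s / 2))
  have hV0 : V ≠ 0 := (measure_closedBall_pos _ _ (by positivity)).ne'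
  have hvol : ∀ k, (100 ^ n) ^ k * volume (closedBall x (r k / 2)) = V := by
    intro k
    simp only [V]
    rw [Measure.addHaar_closedBall _ _ (by have := hr0 k; positivity),
      Measure.addHaar_closedBall _ _ (by positivity), ← mul_assoc]
    congr 1
    have h100 : (100 : ENNReal) = ENNReal.ofReal 100 := by simp
    rw [h100, ← ENNReal.ofReal_pow (by norm_num), ← ENNReal.ofReal_pow (by positivity),
      ← ENNReal.ofReal_mul (by positivity)]
    congr 1
    simp only [hr, finrank_euclideanSpace, Fintype.card_fin, div_pow]
    rw [← pow_mul, ← pow_mul, mul_comm k n]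
    field_simp
  have hlow : ∀ k, V / M * 100 ^ k ≤
      volume (closedBall x (r k / 2)) / μ (closedBall x (r k / 2)) := by
    intro k
    have hcb : μ (closedBall x (r k / 2)) ≠ 0 :=
      ((hpos _ (half_pos (hr0 k))).trans_le (measure_mono ball_subset_closedBall)).ne'
    have hcbtop : μ (closedBall x (r k / 2)) ≠ ⊤ := measure_closedBall_lt_top.ne
    rw [ENNReal.le_div_iff_mul_le (Or.inl hcb) (Or.inl hcbtop)]
    have hsub : μ (closedBall x (r k / 2)) ≤ μ (ball x (r k)) :=
      measure_mono (closedBall_subset_ball (half_lt_self (hr0 k)))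
    have hk := (mul_le_mul_right hsub ((100 ^ (n + 1)) ^ k)).trans (hdecay k)
    rw [← hvol k]
    set v := volume (closedBall x (r k / 2))
    set m := μ (closedBall x (r k / 2))
    calc (100 ^ n) ^ k * v / M * 100 ^ k * m
        = v * ((100 ^ (n + 1)) ^ k * m) / M := by
          simp only [div_eq_mul_inv]; ring
      _ ≤ v * M / M := by gcongr
      _ = v := ENNReal.mul_div_cancel_right hM0 hMtop
  have hr_lim : Tendsto (fun k => r k / 2) atTop (𝓝[>] 0) := by
    refine tendsto_nhdsWithin_iff.2 ⟨?_, Eventually.of_forall fun k => half_pos (hr0 k)⟩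
    have h := (tendsto_inv_atTop_zero.comp
      (tendsto_pow_atTop_atTop_of_one_lt (by norm_num : (1 : ℝ) < 100))).const_mul (s / 2)
    rw [mul_zero] at h
    refine h.congr fun k => ?_
    simp only [hr, Function.comp]
    ring
  have hup : Tendsto (fun k : ℕ => V / M * 100 ^ k) atTop (𝓝 ⊤) := by
    have h := ENNReal.Tendsto.const_mul (a := V / M)
      (ENNReal.tendsto_pow_atTop_nhds_top_iff.2 (by norm_num : (1 : ENNReal) < 100))
      (Or.inl ENNReal.top_ne_zero)
    rwa [ENNReal.mul_top (ENNReal.div_pos hV0 hMtop).ne'] at h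
  exact top_le_iff.1 (le_of_tendsto_of_tendsto' hup (hL.comp hr_lim) hlow)

/-- For a locally finite Borel measure `μ` on `ℝⁿ` and any `c > 2·100^{n+1}`, the set
of points `x` (with all balls of positive measure) where
`liminf_{t→0⁺} μ(B(x,100t))/μ(B(x,t)) ≥ c` is `μ`-null; consequently, `μ`-a.e. point
`w` with all balls of positive measure admits arbitrarily small radii `r` with
`μ(B(w,100r)) ≤ c μ(B(w,r))`. -/
theorem null_of_liminf_doubling_ratio_large
    (n : ℕ) (hn : 1 ≤ n)
    (μ : Measure (EuclideanSpace ℝ (Fin n))) [IsLocallyFiniteMeasure μ]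
    (c : ℝ) (hc : 2 * 100 ^ (n + 1) < c) :
    μ {x | (∀ t : ℝ, 0 < t → 0 < μ (ball x t)) ∧
        ENNReal.ofReal c ≤
          liminf (fun t : ℝ => μ (ball x (100 * t)) / μ (ball x t)) (𝓝[>] 0)} = 0 ∧
    ∀ᵐ w ∂μ, (∀ t : ℝ, 0 < t → 0 < μ (ball w t)) →
      ∀ ε : ℝ, 0 < ε → ∃ r : ℝ, 0 < r ∧ r < ε ∧
        μ (ball w (100 * r)) ≤ ENNReal.ofReal c * μ (ball w r) := by
  have hc0 : (0 : ℝ) < 100 ^ (n + 1) := by positivity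
  have hnull : ∀ᵐ x ∂μ, ¬ ((∀ t : ℝ, 0 < t → 0 < μ (ball x t)) ∧ ENNReal.ofReal c ≤
      liminf (fun t : ℝ => μ (ball x (100 * t)) / μ (ball x t)) (𝓝[>] 0)) := by
    filter_upwards [Besicovitch.ae_tendsto_rnDeriv volume μ, Measure.rnDeriv_lt_top volume μ]
      with x hx hlt ⟨hpos, hlim⟩
    have hd : (100 : ENNReal) ^ (n + 1) < ENNReal.ofReal c := by
      have h100 : (100 : ENNReal) = ENNReal.ofReal 100 := by simp
      rw [h100, ← ENNReal.ofReal_pow (by norm_num)]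
      exact (ENNReal.ofReal_lt_ofReal_iff (by linarith)).2 (by linarith)
    have hev := eventually_lt_of_lt_liminf (hd.trans_le hlim)
    obtain ⟨t₀, ht₀, hsub⟩ := mem_nhdsGT_iff_exists_Ioo_subset.1 hev
    refine hlt.ne (eq_top_of_tendsto_volume_div_of_ball_growth hpos ht₀ (fun t ht htt => ?_) hx)
    have h : (100 : ENNReal) ^ (n + 1) < μ (ball x (100 * t)) / μ (ball x t) := hsub ⟨ht, htt⟩
    exact (ENNReal.le_div_iff_mul_le (Or.inl (hpos t ht).ne')
      (Or.inl measure_ball_lt_top.ne)).1 h.le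
  refine ⟨by simpa [ae_iff] using hnull, ?_⟩
  filter_upwards [hnull] with w hw hpos ε hε
  by_contra! hcon
  refine hw ⟨hpos, le_liminf_of_le (by isBoundedDefault) ?_⟩
  filter_upwards [Ioo_mem_nhdsGT hε] with t ht
  exact (ENNReal.le_div_iff_mul_le (Or.inl (hpos t ht.1).ne')
    (Or.inl measure_ball_lt_top.ne)).2 (hcon t ht.1 ht.2).le
end

section
/- Let n ≥ 1, let μ be a finite Borel measure on ℝⁿ, let λ be a gauge, let a > 0, and let (E_m)_{m≥1} be Borel subsets of ℝⁿ and (δ_m)_{m≥1} positive numbers with δ_m → 0, such that μ(E_m) ≥ a and H^λ_{δ_m}(E_m) ≤ 2^{−m} for every m. Then the set E' = ⋂_{k≥1} ⋃_{m≥k} E_m satisfies H^λ(E') = 0 and μ(E') ≥ a. -/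
open MeasureTheory Metric Filter Topology
open scoped ENNReal

/-- The `(δ, λ)`-Hausdorff content of `E ⊆ ℝⁿ`: the infimum of `Σᵢ λ(rᵢ)` over
countable coverings of `E` by balls `B(xᵢ, rᵢ)` with `0 < rᵢ < δ` (balls of
nonpositive radius are empty and contribute nothing). -/
noncomputable def hContent (n : ℕ) (lam : ℝ → ℝ) (δ : ℝ)
    (E : Set (EuclideanSpace ℝ (Fin n))) : ℝ≥0∞ :=
  ⨅ (c : ℕ → EuclideanSpace ℝ (Fin n) × ℝ)
    (_ : E ⊆ ⋃ i, ball (c i).1 (c i).2) (_ : ∀ i, (c i).2 < δ),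
    ∑' i, if 0 < (c i).2 then ENNReal.ofReal (lam (c i).2) else 0

/-- The generalized Hausdorff measure `H^λ(E) = lim_{δ→0} H^λ_δ(E)`. -/
noncomputable def hMeasure (n : ℕ) (lam : ℝ → ℝ)
    (E : Set (EuclideanSpace ℝ (Fin n))) : ℝ≥0∞ :=
  ⨆ (δ : ℝ) (_ : 0 < δ), hContent n lam δ E

theorem hContent_le_tsum {n : ℕ} {lam : ℝ → ℝ} {δ : ℝ} {E : Set (EuclideanSpace ℝ (Fin n))}
    (c : ℕ → EuclideanSpace ℝ (Fin n) × ℝ) (hc : E ⊆ ⋃ i, ball (c i).1 (c i).2)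
    (hr : ∀ i, (c i).2 < δ) :
    hContent n lam δ E ≤ ∑' i, if 0 < (c i).2 then ENNReal.ofReal (lam (c i).2) else 0 :=
  iInf_le_of_le c (iInf_le_of_le hc (iInf_le _ hr))

theorem hContent_mono {n : ℕ} {lam : ℝ → ℝ} {δ δ' : ℝ} {E F : Set (EuclideanSpace ℝ (Fin n))}
    (hEF : E ⊆ F) (hδ : δ' ≤ δ) : hContent n lam δ E ≤ hContent n lam δ' F :=
  le_iInf fun c => le_iInf fun hc => le_iInf fun hr =>
    hContent_le_tsum c (hEF.trans hc) fun i => (hr i).trans_le hδ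

theorem exists_cover_of_hContent_lt {n : ℕ} {lam : ℝ → ℝ} {δ : ℝ}
    {E : Set (EuclideanSpace ℝ (Fin n))} {b : ℝ≥0∞} (h : hContent n lam δ E < b) :
    ∃ c : ℕ → EuclideanSpace ℝ (Fin n) × ℝ, E ⊆ ⋃ i, ball (c i).1 (c i).2 ∧
      (∀ i, (c i).2 < δ) ∧
      ∑' i, (if 0 < (c i).2 then ENNReal.ofReal (lam (c i).2) else 0) < b := by
  simpa only [hContent, iInf_lt_iff, exists_prop] using h

theorem hContent_iUnion_le {n : ℕ} {lam : ℝ → ℝ} {δ : ℝ}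
    (F : ℕ → Set (EuclideanSpace ℝ (Fin n))) :
    hContent n lam δ (⋃ m, F m) ≤ ∑' m, hContent n lam δ (F m) := by
  refine ENNReal.le_of_forall_pos_le_add fun ε hε hfin => ?_
  obtain ⟨ε', hε'pos, hε'⟩ :=
    ENNReal.exists_pos_sum_of_countable (ENNReal.coe_pos.2 hε).ne' ℕ
  have hlt : ∀ m, hContent n lam δ (F m) < hContent n lam δ (F m) + ε' m := fun m =>
    ENNReal.lt_add_right (ENNReal.ne_top_of_tsum_ne_top hfin.ne m)
      (ENNReal.coe_pos.2 (hε'pos m)).ne'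
  choose c hc hr hsum using fun m => exists_cover_of_hContent_lt (hlt m)
  let d : ℕ → EuclideanSpace ℝ (Fin n) × ℝ := fun j => c j.unpair.1 j.unpair.2
  have hd : ⋃ m, F m ⊆ ⋃ j, ball (d j).1 (d j).2 := by
    refine Set.iUnion_subset fun m => (hc m).trans (Set.iUnion_subset fun i => ?_)
    refine Set.subset_iUnion_of_subset (Nat.pair m i) ?_
    simp [d]
  calc hContent n lam δ (⋃ m, F m)
      ≤ ∑' j, if 0 < (d j).2 then ENNReal.ofReal (lam (d j).2) else 0 :=
        hContent_le_tsum d hd fun j => hr _ _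
    _ = ∑' p : ℕ × ℕ,
          if 0 < (c p.1 p.2).2 then ENNReal.ofReal (lam (c p.1 p.2).2) else 0 :=
        Nat.pairEquiv.symm.tsum_eq fun p : ℕ × ℕ =>
          if 0 < (c p.1 p.2).2 then ENNReal.ofReal (lam (c p.1 p.2).2) else 0
    _ = ∑' m, ∑' i, if 0 < (c m i).2 then ENNReal.ofReal (lam (c m i).2) else 0 :=
        ENNReal.tsum_prod (f := fun m i =>
          if 0 < (c m i).2 then ENNReal.ofReal (lam (c m i).2) else 0)
    _ ≤ ∑' m, (hContent n lam δ (F m) + ε' m) := ENNReal.tsum_le_tsum fun m => (hsum m).le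
    _ = ∑' m, hContent n lam δ (F m) + ∑' m, (ε' m : ℝ≥0∞) := ENNReal.tsum_add
    _ ≤ ∑' m, hContent n lam δ (F m) + ε := by gcongr

/-- If `μ(E_m) ≥ a` and `H^λ_{δ_m}(E_m) ≤ 2^{-m}` with `δ_m → 0`, then
`E' = ⋂_k ⋃_{m ≥ k} E_m` satisfies `H^λ(E') = 0` and `μ(E') ≥ a`. -/
theorem hMeasure_zero_of_content_summable
    (n : ℕ) (hn : 1 ≤ n)
    (μ : Measure (EuclideanSpace ℝ (Fin n))) [IsFiniteMeasure μ]
    (lam : ℝ → ℝ) (hmono : MonotoneOn lam (Set.Ioi (0 : ℝ)))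
    (hpos : ∀ t : ℝ, 0 < t → 0 < lam t)
    (a : ℝ) (ha : 0 < a)
    (E : ℕ → Set (EuclideanSpace ℝ (Fin n))) (hEmeas : ∀ m, MeasurableSet (E m))
    (δ : ℕ → ℝ) (hδpos : ∀ m, 0 < δ m) (hδ : Tendsto δ atTop (𝓝 0))
    (hμE : ∀ m, ENNReal.ofReal a ≤ μ (E m))
    (hcont : ∀ m, hContent n lam (δ m) (E m) ≤ (2 : ℝ≥0∞)⁻¹ ^ m) :
    hMeasure n lam (⋂ k, ⋃ m ∈ Set.Ici k, E m) = 0 ∧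
      ENNReal.ofReal a ≤ μ (⋂ k, ⋃ m ∈ Set.Ici k, E m) := by
  constructor
  · simp only [hMeasure, ENNReal.iSup_eq_zero]
    intro η hη
    have htail : Tendsto (fun k => ∑' m, (2 : ℝ≥0∞)⁻¹ ^ (m + k)) atTop (𝓝 0) :=
      ENNReal.tendsto_sum_nat_add _ (by simp [ENNReal.tsum_geometric])
    refine le_antisymm (ge_of_tendsto htail ?_) zero_le
    filter_upwards [eventually_forall_ge_atTop.2 (hδ.eventually_lt_const hη)] with k hk
    have hsub : ⋂ k, ⋃ m ∈ Set.Ici k, E m ⊆ ⋃ m, E (m + k) := by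
      refine (Set.iInter_subset _ k).trans (Set.iUnion₂_subset fun m hm => ?_)
      exact Set.subset_iUnion_of_subset (m - k) (congrArg E (Nat.sub_add_cancel hm)).ge
    calc hContent n lam η (⋂ k, ⋃ m ∈ Set.Ici k, E m)
        ≤ hContent n lam η (⋃ m, E (m + k)) := hContent_mono hsub le_rfl
      _ ≤ ∑' m, hContent n lam η (E (m + k)) := hContent_iUnion_le _
      _ ≤ ∑' m, (2 : ℝ≥0∞)⁻¹ ^ (m + k) := ENNReal.tsum_le_tsum fun m =>
          (hContent_mono subset_rfl (hk _ (Nat.le_add_left k m)).le).trans (hcont _)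
  · have hanti : Antitone fun k => ⋃ m ∈ Set.Ici k, E m := fun k l hkl =>
      Set.biUnion_subset_biUnion_left (Set.Ici_subset_Ici.2 hkl)
    rw [hanti.measure_iInter
      (fun k => (MeasurableSet.biUnion (Set.to_countable _) fun m _ => hEmeas m).nullMeasurableSet)
      ⟨0, measure_ne_top _ _⟩]
    exact le_iInf fun k => (hμE k).trans
      (measure_mono (Set.subset_biUnion_of_mem (u := E) Set.self_mem_Ici))
end

section
/- Let n ≥ 2, let μ be a locally finite Borel measure on ℝⁿ, and let K ⊆ ℝⁿ be a set such that lim_{t→0⁺} sup_{x∈K} μ(B(x,t))/t^{n−1} = 0. Then there exists a nondecreasing function λ : (0,1] → (0,∞) such that: (a) λ(t)/t^{n−1} → 0 as t → 0⁺; (b) λ(2t) ≤ 2^{n+1}·λ(t) for all 0 < t ≤ 1/2; and (c) lim_{t→0⁺} sup_{x∈K} μ(B(x,t))/λ(t) = 0. -/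
open MeasureTheory Metric Filter Topology
open scoped ENNReal

/-- A bounded function tending to `0` at `0⁺` has a positive nondecreasing majorant with the same
limit and the doubling property `φ (2t) ≤ 2 φ t`. -/
theorem exists_monotone_doubling_majorant {r : ℝ → ℝ} (h0 : ∀ s, 0 ≤ r s) (h1 : ∀ s, r s ≤ 1)
    (hr : Tendsto r (𝓝[>] 0) (𝓝 0)) :
    ∃ φ : ℝ → ℝ, MonotoneOn φ (Set.Ioi 0) ∧ (∀ t, 0 < t → 0 < φ t) ∧ (∀ t, 0 < t → r t ≤ φ t) ∧
      (∀ t, 0 < t → φ (2 * t) ≤ 2 * φ t) ∧ Tendsto φ (𝓝[>] 0) (𝓝 0) := by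
  let ψ : ℝ → ℝ := fun t => ⨆ s : Set.Ioi (0 : ℝ), r s * min 1 (t / s)
  have : Nonempty (Set.Ioi (0 : ℝ)) := ⟨⟨1, Set.mem_Ioi.2 one_pos⟩⟩
  have hbdd : ∀ t : ℝ, BddAbove (Set.range fun s : Set.Ioi (0 : ℝ) => r s * min 1 (t / s)) := by
    intro t
    refine ⟨1, ?_⟩
    rintro _ ⟨s, rfl⟩
    exact (mul_le_of_le_one_right (h0 _) (min_le_left _ _)).trans (h1 _)
  have hle : ∀ t s, 0 < s → r s * min 1 (t / s) ≤ ψ t := fun t s hs =>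
    le_ciSup (hbdd t) (⟨s, hs⟩ : Set.Ioi (0 : ℝ))
  have hψ : ∀ t, 0 < t → r t ≤ ψ t := by
    intro t ht
    simpa [div_self ht.ne'] using hle t t ht
  have hmono : Monotone ψ := by
    intro a b hab
    refine ciSup_le fun s => le_trans ?_ (hle b s s.2)
    have hs : (0 : ℝ) < s := s.2
    have := h0 s
    gcongr
  refine ⟨fun t => t + ψ t, ?_, ?_, ?_, ?_, ?_⟩
  · intro a _ b _ hab
    exact add_le_add hab (hmono hab)
  · intro t ht
    have := hψ t ht
    have := h0 t
    dsimp only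
    linarith
  · intro t ht
    have := hψ t ht
    dsimp only
    linarith
  · intro t ht
    have : ψ (2 * t) ≤ 2 * ψ t := by
      refine ciSup_le fun s => ?_
      have hs : (0 : ℝ) < s := s.2
      have hmin : min 1 (2 * t / s) ≤ 2 * min 1 (t / s) := by
        rw [mul_min_of_nonneg _ _ zero_le_two, mul_div_assoc]
        exact min_le_min_right _ (by norm_num)
      have := mul_le_mul_of_nonneg_left hmin (h0 s)
      have := hle t s hs
      linarith
    dsimp only
    linarith
  · have hψ0 : Tendsto ψ (𝓝[>] 0) (𝓝 0) := by
      refine Metric.tendsto_nhdsWithin_nhds.2 fun ε hε => ?_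
      obtain ⟨δ, hδ, hrδ⟩ := Metric.tendsto_nhdsWithin_nhds.1 hr (ε / 2) (half_pos hε)
      refine ⟨δ * (ε / 2), by positivity, fun t ht htδ => ?_⟩
      have ht0 : 0 < t := ht
      rw [Real.dist_eq, sub_zero] at htδ ⊢
      rw [abs_of_pos ht0] at htδ
      rw [abs_of_nonneg ((h0 t).trans (hψ t ht0))]
      refine lt_of_le_of_lt (ciSup_le fun s => ?_) (half_lt_self hε)
      have hs : (0 : ℝ) < s := s.2
      rcases lt_or_ge (s : ℝ) δ with hsδ | hsδ
      · have hrs := hrδ s.2 (by rwa [Real.dist_eq, sub_zero, abs_of_pos hs])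
        rw [Real.dist_eq, sub_zero] at hrs
        exact (mul_le_of_le_one_right (h0 _) (min_le_left _ _)).trans
          ((le_abs_self _).trans hrs.le)
      · have hts : t / s ≤ ε / 2 := by
          rw [div_le_iff₀ hs]
          nlinarith
        have hmin : 0 ≤ min 1 (t / s) := by positivity
        exact (mul_le_of_le_one_left hmin (h1 _)).trans ((min_le_right _ _).trans hts)
    have hid : Tendsto (fun t : ℝ => t) (𝓝[>] 0) (𝓝 0) := tendsto_nhdsWithin_of_tendsto_nhds
      tendsto_id
    simpa using hid.add hψ0

/-- If `sup_{x∈K} μ(B(x,t))/t^{n-1} → 0` as `t → 0⁺`, there is a nondecreasing positive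
gauge `λ` on `(0,1]` with `λ(t)/t^{n-1} → 0`, the doubling property
`λ(2t) ≤ 2^{n+1} λ(t)`, and `sup_{x∈K} μ(B(x,t))/λ(t) → 0` as `t → 0⁺`. -/
theorem exists_gauge_dominating_density
    (n : ℕ) (hn : 2 ≤ n)
    (μ : Measure (EuclideanSpace ℝ (Fin n))) [IsLocallyFiniteMeasure μ]
    (K : Set (EuclideanSpace ℝ (Fin n)))
    (h : Tendsto (fun t : ℝ => ⨆ x ∈ K, μ (ball x t) / ENNReal.ofReal (t ^ (n - 1)))
      (𝓝[>] 0) (𝓝 0)) :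
    ∃ lam : ℝ → ℝ,
      MonotoneOn lam (Set.Ioc (0 : ℝ) 1) ∧
      (∀ t ∈ Set.Ioc (0 : ℝ) 1, 0 < lam t) ∧
      Tendsto (fun t : ℝ => lam t / t ^ (n - 1)) (𝓝[>] 0) (𝓝 0) ∧
      (∀ t : ℝ, 0 < t → t ≤ 1 / 2 → lam (2 * t) ≤ 2 ^ (n + 1) * lam t) ∧
      Tendsto (fun t : ℝ => ⨆ x ∈ K, μ (ball x t) / ENNReal.ofReal (lam t))
        (𝓝[>] 0) (𝓝 0) := by
  set g : ℝ → ℝ≥0∞ := fun t => ⨆ x ∈ K, μ (ball x t) / ENNReal.ofReal (t ^ (n - 1))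
  let r : ℝ → ℝ := fun t => √(min 1 (g t)).toReal
  have hr : Tendsto r (𝓝[>] 0) (𝓝 0) := by
    have hmin : Tendsto (fun t => min 1 (g t)) (𝓝[>] 0) (𝓝 0) := by
      simpa using (tendsto_const_nhds (x := (1 : ℝ≥0∞))).min h
    simpa using ((ENNReal.tendsto_toReal ENNReal.zero_ne_top).comp hmin).sqrt
  have hr1 : ∀ s, r s ≤ 1 := fun s => by
    refine Real.sqrt_le_iff.2 ⟨zero_le_one, ?_⟩
    rw [one_pow]
    exact ENNReal.toReal_le_of_le_ofReal zero_le_one (by simp)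
  obtain ⟨φ, hmono, hpos, hle, hdouble, hφ⟩ :=
    exists_monotone_doubling_majorant (fun s => Real.sqrt_nonneg _) hr1 hr
  refine ⟨fun t => t ^ (n - 1) * φ t, ?_, ?_, ?_, ?_, ?_⟩
  · intro a ha b hb hab
    have ha0 : 0 < a := ha.1
    have hab' := hmono ha.1 hb.1 hab
    have hφa := hpos a ha0
    exact mul_le_mul (pow_le_pow_left₀ ha0.le hab _) hab' hφa.le (pow_nonneg (ha0.le.trans hab) _)
  · intro t ht
    exact mul_pos (pow_pos ht.1 _) (hpos t ht.1)
  · refine hφ.congr' ?_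
    filter_upwards [self_mem_nhdsWithin] with t ht
    have ht0 : 0 < t := ht
    field_simp
  · intro t ht _
    have hφt := hpos t ht
    calc (2 * t) ^ (n - 1) * φ (2 * t) ≤ (2 * t) ^ (n - 1) * (2 * φ t) := by
          gcongr
          exact hdouble t ht
      _ = 2 ^ (n - 1 + 1) * (t ^ (n - 1) * φ t) := by ring
      _ ≤ 2 ^ (n + 1) * (t ^ (n - 1) * φ t) := by
          gcongr
          · norm_num
          · omega
  · have hr' : Tendsto (fun t => ENNReal.ofReal (r t)) (𝓝[>] 0) (𝓝 0) := by
      simpa using ENNReal.tendsto_ofReal hr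
    refine tendsto_of_tendsto_of_tendsto_of_le_of_le' tendsto_const_nhds hr'
      (Eventually.of_forall fun _ => zero_le) ?_
    filter_upwards [self_mem_nhdsWithin, h.eventually (ge_mem_nhds one_pos)] with t ht hgt
    have ht0 : 0 < t := ht
    have hφt := hpos t ht0
    have hgr : g t ≤ ENNReal.ofReal (r t) * ENNReal.ofReal (φ t) := by
      have hsq : r t * r t = (g t).toReal := by
        rw [Real.mul_self_sqrt ENNReal.toReal_nonneg, min_eq_right hgt]
      rw [← ENNReal.ofReal_mul (Real.sqrt_nonneg _)]
      refine (ENNReal.ofReal_toReal (ne_top_of_le_ne_top ENNReal.one_ne_top hgt)).ge.trans ?_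
      rw [← hsq]
      exact ENNReal.ofReal_le_ofReal
        (mul_le_mul_of_nonneg_left (hle t ht0) (Real.sqrt_nonneg _))
    refine iSup₂_le fun x hx => ?_
    have hx' : μ (ball x t) / ENNReal.ofReal (t ^ (n - 1)) ≤ g t :=
      le_iSup₂ (f := fun x _ => μ (ball x t) / ENNReal.ofReal (t ^ (n - 1))) x hx
    have htn : 0 < t ^ (n - 1) := pow_pos ht0 _
    have hne : ENNReal.ofReal (t ^ (n - 1)) ≠ 0 := by simpa using htn
    refine ENNReal.div_le_of_le_mul ?_
    rw [ENNReal.ofReal_mul htn.le]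
    calc μ (ball x t) ≤ g t * ENNReal.ofReal (t ^ (n - 1)) :=
          (ENNReal.div_le_iff hne ENNReal.ofReal_ne_top).1 hx'
      _ ≤ ENNReal.ofReal (r t) * ENNReal.ofReal (φ t) * ENNReal.ofReal (t ^ (n - 1)) := by gcongr
      _ = _ := by ring
end

section
/- Let n ≥ 2 and let μ be a finite Borel measure on ℝⁿ. Suppose that for every nondecreasing function λ : (0,1] → (0,∞) with lim_{t→0⁺} λ(t)/t^{n−1} = 0 there exists a Borel set Q₁ ⊆ ℝⁿ with μ(ℝⁿ ∖ Q₁) = 0 and H^λ(Q₁) = 0. Then μ(ℝⁿ ∖ P) = 0, where P = {x ∈ ℝⁿ : limsup_{t→0⁺} μ(B(x,t))/t^{n−1} > 0}; consequently μ is concentrated on a set of σ-finite H^{n−1} measure, i.e. there is a Borel set S = ⋃_{i=1}^{∞} S_i with H^{n−1}(S_i) < ∞ for each i and μ(ℝⁿ ∖ S) = 0. -/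
open MeasureTheory Metric Filter Topology
open scoped ENNReal

section UpperDensity

variable {X : Type*} [MetricSpace X] [MeasurableSpace X]

/-- The points all of whose balls of radius `t < 1 / (k + 1)` have `μ`-measure at most
`t ^ d / (m + 1)`. -/
def smallDensitySet (μ : Measure X) (d m k : ℕ) : Set X :=
  {x | ∀ t : ℝ, 0 < t → t < 1 / ((k : ℝ) + 1) →
    μ (ball x t) ≤ ((m : ℝ≥0∞) + 1)⁻¹ * ENNReal.ofReal (t ^ d)}

theorem isClosed_setOf_measure_ball_le (μ : Measure X) (t : ℝ) (c : ℝ≥0∞) :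
    IsClosed {x | μ (ball x t) ≤ c} := by
  rw [← isOpen_compl_iff, Metric.isOpen_iff]
  intro x hx
  simp only [Set.mem_compl_iff, Set.mem_ofPred_eq, not_le] at hx
  have hmono : Monotone fun j : ℕ => ball x (t - 1 / ((j : ℝ) + 1)) := fun i j hij =>
    ball_subset_ball (sub_le_sub_left (Nat.one_div_le_one_div hij) t)
  have hunion : ball x t = ⋃ j : ℕ, ball x (t - 1 / ((j : ℝ) + 1)) := by
    refine Set.Subset.antisymm (fun y hy => ?_)
      (Set.iUnion_subset fun j => ball_subset_ball (sub_le_self t Nat.one_div_pos_of_nat.le))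
    obtain ⟨j, hj⟩ := exists_nat_one_div_lt (sub_pos.2 (mem_ball.1 hy))
    exact Set.mem_iUnion.2 ⟨j, mem_ball.2 (by linarith)⟩
  rw [hunion, hmono.measure_iUnion, lt_iSup_iff] at hx
  obtain ⟨j, hj⟩ := hx
  refine ⟨1 / ((j : ℝ) + 1), Nat.one_div_pos_of_nat, fun y hy => ?_⟩
  simp only [Set.mem_compl_iff, Set.mem_ofPred_eq, not_le]
  refine hj.trans_le (measure_mono (ball_subset_ball' ?_))
  have := mem_ball'.1 hy
  linarith

theorem isClosed_smallDensitySet (μ : Measure X) (d m k : ℕ) :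
    IsClosed (smallDensitySet μ d m k) := by
  simp only [smallDensitySet, Set.ofPred_forall]
  exact isClosed_iInter fun t => isClosed_iInter fun _ => isClosed_iInter fun _ =>
    isClosed_setOf_measure_ball_le μ t _

theorem monotone_smallDensitySet (μ : Measure X) (d m : ℕ) :
    Monotone (smallDensitySet μ d m) := fun _ _ hij _ hx t ht htk =>
  hx t ht (htk.trans_le (Nat.one_div_le_one_div hij))

theorem measurableSet_iUnion_smallDensitySet [BorelSpace X] (μ : Measure X) (d m : ℕ) :
    MeasurableSet (⋃ k, smallDensitySet μ d m k) :=
  MeasurableSet.iUnion fun k => (isClosed_smallDensitySet μ d m k).measurableSet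

theorem mem_iUnion_smallDensitySet_of_limsup_eq_zero (μ : Measure X) (d m : ℕ) {x : X}
    (hx : limsup (fun t : ℝ => μ (ball x t) / ENNReal.ofReal (t ^ d)) (𝓝[>] 0) = 0) :
    x ∈ ⋃ k, smallDensitySet μ d m k := by
  have hpos : limsup (fun t : ℝ => μ (ball x t) / ENNReal.ofReal (t ^ d)) (𝓝[>] 0)
      < ((m : ℝ≥0∞) + 1)⁻¹ := by
    rw [hx, ENNReal.inv_pos]
    finiteness
  obtain ⟨s, hs, hsub⟩ := mem_nhdsGT_iff_exists_Ioo_subset.1 (eventually_lt_of_limsup_lt hpos)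
  obtain ⟨k, hk⟩ := exists_nat_one_div_lt (Set.mem_Ioi.1 hs)
  refine Set.mem_iUnion.2 ⟨k, fun t ht htk => ?_⟩
  have hlt : μ (ball x t) / ENNReal.ofReal (t ^ d) < ((m : ℝ≥0∞) + 1)⁻¹ :=
    hsub ⟨ht, htk.trans hk⟩
  exact (ENNReal.div_le_iff (by simpa using pow_pos ht d) ENNReal.ofReal_ne_top).1 hlt.le

/-- A set of points of positive upper `d`-density has finite `d`-dimensional Hausdorff measure. -/
theorem hausdorffMeasure_compl_iUnion_smallDensitySet_lt_top [BorelSpace X]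
    [TopologicalSpace.SeparableSpace X] (μ : Measure X) [IsFiniteMeasure μ] (d m : ℕ) :
    μH[(d : ℝ)] (⋃ k, smallDensitySet μ d m k)ᶜ < ⊤ := by
  set S : Set X := (⋃ k, smallDensitySet μ d m k)ᶜ
  have hex : ∀ k : ℕ, ∀ x ∈ S, ∃ t : ℝ, 0 < t ∧ t < 1 / ((k : ℝ) + 1) ∧
      ((m : ℝ≥0∞) + 1)⁻¹ * ENNReal.ofReal (t ^ d) < μ (ball x t) := by
    intro k x hx
    have hxk : x ∉ smallDensitySet μ d m k := fun hk => hx (Set.mem_iUnion.2 ⟨k, hk⟩)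
    simpa [smallDensitySet] using hxk
  choose! r hr0 hrk hrμ using hex
  choose u huS hudisj hucover using fun k : ℕ =>
    Vitali.exists_disjoint_subfamily_covering_enlargement_closedBall S (fun x : X => x) (r k)
      (1 / ((k : ℝ) + 1)) (fun x hx => (hrk k x hx).le) 5 (by norm_num)
  have hcount : ∀ k, Countable (u k) := fun k =>
    ((hudisj k).countable_of_nonempty_interior fun x hx =>
      ⟨x, ball_subset_interior_closedBall (mem_ball_self (hr0 k x (huS k hx)))⟩).to_subtype
  have hdiam : ∀ k, ∀ x ∈ u k,
      ediam (closedBall x (5 * r k x)) ≤ ENNReal.ofReal (10 * r k x) := by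
    intro k x hx
    rw [← Metric.closedEBall_ofReal (by linarith [hr0 k x (huS k hx)])]
    refine Metric.ediam_closedEBall_le.trans_eq ?_
    rw [← ENNReal.ofReal_ofNat 2, ← ENNReal.ofReal_mul zero_le_two]
    ring_nf
  have hsum : ∀ k, ∑' i : u k, ediam (closedBall (i : X) (5 * r k i)) ^ (d : ℝ)
      ≤ ENNReal.ofReal (10 ^ d) * ((m : ℝ≥0∞) + 1) * μ Set.univ := by
    intro k
    calc ∑' i : u k, ediam (closedBall (i : X) (5 * r k i)) ^ (d : ℝ)
        ≤ ∑' i : u k, ENNReal.ofReal (10 ^ d) * ((m : ℝ≥0∞) + 1) * μ (ball (i : X) (r k i)) := by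
          refine ENNReal.tsum_le_tsum fun i => ?_
          have hi := huS k i.2
          have h1 := hrμ k i hi
          rw [← ENNReal.div_eq_inv_mul] at h1
          have h2 := (ENNReal.div_le_iff (by simp) (by finiteness)).1 h1.le
          calc ediam (closedBall (i : X) (5 * r k i)) ^ (d : ℝ)
              ≤ ENNReal.ofReal (10 * r k i) ^ d := by
                rw [ENNReal.rpow_natCast]
                gcongr
                exact hdiam k i i.2
            _ = ENNReal.ofReal (10 ^ d) * ENNReal.ofReal (r k i ^ d) := by
                rw [← ENNReal.ofReal_pow (by linarith [hr0 k i hi]), mul_pow,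
                  ENNReal.ofReal_mul (by positivity)]
            _ ≤ ENNReal.ofReal (10 ^ d) * (μ (ball (i : X) (r k i)) * ((m : ℝ≥0∞) + 1)) := by
                gcongr
            _ = _ := by ring
      _ = ENNReal.ofReal (10 ^ d) * ((m : ℝ≥0∞) + 1) * ∑' i : u k, μ (ball (i : X) (r k i)) :=
          ENNReal.tsum_mul_left
      _ ≤ _ := by
          gcongr
          refine (tsum_meas_le_meas_iUnion_of_disjoint μ (fun i => isOpen_ball.measurableSet)
            fun i j hij => ?_).trans (measure_mono (Set.subset_univ _))
          exact (hudisj k i.2 j.2 (Subtype.coe_injective.ne hij)).mono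
            ball_subset_closedBall ball_subset_closedBall
  have hrad : Tendsto (fun k : ℕ => ENNReal.ofReal (10 * (1 / ((k : ℝ) + 1)))) atTop (𝓝 0) := by
    simpa using ENNReal.tendsto_ofReal (tendsto_one_div_add_atTop_nhds_zero_nat.const_mul (10 : ℝ))
  refine (Measure.hausdorffMeasure_le_liminf_tsum (d : ℝ) S _ hrad
    (fun k (i : u k) => closedBall (i : X) (5 * r k i)) ?_ ?_).trans_lt ?_
  · filter_upwards with k i
    refine (hdiam k i i.2).trans (ENNReal.ofReal_le_ofReal ?_)
    linarith [hrk k i (huS k i.2)]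
  · filter_upwards with k x hx
    obtain ⟨y, hy, hsub⟩ := hucover k x hx
    exact Set.mem_iUnion.2 ⟨⟨y, hy⟩, hsub (mem_closedBall_self (hr0 k x hx).le)⟩
  · refine (liminf_le_liminf (Eventually.of_forall hsum)).trans_lt ?_
    rw [liminf_const]
    finiteness

/-- Egorov's theorem for the upper density. -/
theorem exists_measure_diff_iInter_smallDensitySet_le [BorelSpace X] (μ : Measure X)
    [IsFiniteMeasure μ] (d : ℕ) {ε : ℝ≥0∞} (hε : ε ≠ 0) :
    ∃ κ : ℕ → ℕ, μ ((⋂ m, ⋃ k, smallDensitySet μ d m k) \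
      ⋂ m, smallDensitySet μ d m (κ m)) ≤ ε := by
  obtain ⟨δ, hδ, hsum⟩ := ENNReal.exists_pos_sum_of_countable' hε ℕ
  have hex : ∀ m, ∃ k, μ ((⋃ k, smallDensitySet μ d m k) \ smallDensitySet μ d m k) < δ m := by
    intro m
    have hlim := tendsto_measure_iInter_atTop (μ := μ)
      (s := fun k => (⋃ k, smallDensitySet μ d m k) \ smallDensitySet μ d m k)
      (fun k => ((measurableSet_iUnion_smallDensitySet μ d m).diff
        (isClosed_smallDensitySet μ d m k).measurableSet).nullMeasurableSet)
      (fun i j hij => Set.sdiff_subset_sdiff_right (monotone_smallDensitySet μ d m hij))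
      ⟨0, measure_ne_top μ _⟩
    rw [← Set.sdiff_iUnion, sdiff_self, Set.bot_eq_empty, measure_empty] at hlim
    exact (hlim.eventually_lt_const (hδ m)).exists
  choose κ hκ using hex
  refine ⟨κ, (measure_mono ?_).trans ((measure_iUnion_le (μ := μ) fun m =>
    (⋃ k, smallDensitySet μ d m k) \ smallDensitySet μ d m (κ m)).trans
      ((ENNReal.tsum_le_tsum fun m => (hκ m).le).trans hsum.le))⟩
  rintro x ⟨hx, hxκ⟩
  obtain ⟨m, hm⟩ := Set.mem_iInter.not.trans not_forall |>.1 hxκ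
  exact Set.mem_iUnion.2 ⟨m, Set.mem_iInter.1 hx m, hm⟩

/-- The largest measure of a ball of radius `2 * t` centred in `K`, perturbed by `t ^ (d + 1)` to
be positive. -/
noncomputable def densityGauge (μ : Measure X) (d : ℕ) (K : Set X) (t : ℝ) : ℝ :=
  (⨆ x ∈ K, μ (ball x (2 * t))).toReal + t ^ (d + 1)

theorem iSup_measure_ball_ne_top (μ : Measure X) [IsFiniteMeasure μ] (K : Set X) (t : ℝ) :
    (⨆ x ∈ K, μ (ball x t)) ≠ ⊤ :=
  ne_top_of_le_ne_top (measure_ne_top μ Set.univ)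
    (iSup₂_le fun _ _ => measure_mono (Set.subset_univ _))

theorem monotoneOn_densityGauge (μ : Measure X) [IsFiniteMeasure μ] (d : ℕ) (K : Set X) :
    MonotoneOn (densityGauge μ d K) (Set.Ioc 0 1) := by
  intro s hs t _ hst
  have := hs.1.le
  refine add_le_add (ENNReal.toReal_mono (iSup_measure_ball_ne_top μ K _) ?_) (by gcongr)
  exact iSup₂_mono fun x _ => measure_mono (ball_subset_ball (by linarith))

theorem densityGauge_pos (μ : Measure X) (d : ℕ) (K : Set X) {t : ℝ} (ht : 0 < t) :
    0 < densityGauge μ d K t :=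
  add_pos_of_nonneg_of_pos ENNReal.toReal_nonneg (pow_pos ht _)

theorem tendsto_densityGauge_div_pow (μ : Measure X) (d : ℕ) (K : Set X) (κ : ℕ → ℕ)
    (hK : ∀ m, K ⊆ smallDensitySet μ d m (κ m)) :
    Tendsto (fun t : ℝ => densityGauge μ d K t / t ^ d) (𝓝[>] 0) (𝓝 0) := by
  have hbound : ∀ m : ℕ, ∀ᶠ t : ℝ in 𝓝[>] 0,
      densityGauge μ d K t / t ^ d ≤ 2 ^ d * (1 / ((m : ℝ) + 1)) + t := by
    intro m
    have hpos : (0 : ℝ) < 1 / ((κ m : ℝ) + 1) / 2 := by positivity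
    filter_upwards [Ioo_mem_nhdsGT hpos] with t ht
    have ht0 : 0 < t := ht.1
    have hsup : (⨆ x ∈ K, μ (ball x (2 * t))) ≤
        ENNReal.ofReal (1 / ((m : ℝ) + 1) * (2 * t) ^ d) := by
      refine iSup₂_le fun x hx => (hK m hx (2 * t) (by linarith) (by linarith [ht.2])).trans_eq ?_
      rw [ENNReal.ofReal_mul (by positivity), one_div, ENNReal.ofReal_inv_of_pos (by positivity),
        ENNReal.ofReal_add (by positivity) zero_le_one, ENNReal.ofReal_natCast, ENNReal.ofReal_one]
    have hreal := ENNReal.toReal_le_of_le_ofReal (by positivity) hsup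
    rw [div_le_iff₀ (pow_pos ht0 d), densityGauge]
    calc _ ≤ 1 / ((m : ℝ) + 1) * (2 * t) ^ d + t ^ (d + 1) := by gcongr
      _ = _ := by ring
  rw [tendsto_order]
  refine ⟨fun a ha => ?_, fun a ha => ?_⟩
  · filter_upwards [self_mem_nhdsWithin] with t ht
    exact ha.trans (div_pos (densityGauge_pos μ d K ht) (pow_pos ht d))
  · obtain ⟨m, hm⟩ := exists_nat_one_div_lt (show 0 < a / 2 / 2 ^ d by positivity)
    filter_upwards [hbound m, Ioo_mem_nhdsGT (half_pos ha)] with t h1 h2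
    rw [lt_div_iff₀ (by positivity)] at hm
    linarith [h2.2]

theorem measure_ball_inter_le_densityGauge (μ : Measure X) [IsFiniteMeasure μ] (d : ℕ) (K : Set X)
    (x : X) {t : ℝ} (ht : 0 < t) :
    μ (ball x t ∩ K) ≤ ENNReal.ofReal (densityGauge μ d K t) := by
  rcases (ball x t ∩ K).eq_empty_or_nonempty with h | ⟨y, hyx, hyK⟩
  · simp [h]
  have hsub : ball x t ∩ K ⊆ ball y (2 * t) :=
    Set.inter_subset_left.trans (ball_subset_ball' (by linarith [mem_ball'.1 hyx]))
  calc μ (ball x t ∩ K) ≤ ⨆ z ∈ K, μ (ball z (2 * t)) :=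
        (measure_mono hsub).trans (le_iSup₂ (f := fun z _ => μ (ball z (2 * t))) y hyK)
    _ = ENNReal.ofReal (⨆ z ∈ K, μ (ball z (2 * t))).toReal :=
        (ENNReal.ofReal_toReal (iSup_measure_ball_ne_top μ K _)).symm
    _ ≤ _ := ENNReal.ofReal_le_ofReal (le_add_of_nonneg_right (by positivity))

end UpperDensity

theorem measure_inter_eq_zero_of_hMeasure_densityGauge {n : ℕ}
    (μ : Measure (EuclideanSpace ℝ (Fin n))) [IsFiniteMeasure μ] (d : ℕ)
    {K Q : Set (EuclideanSpace ℝ (Fin n))} (hQ : hMeasure n (densityGauge μ d K) Q = 0) :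
    μ (Q ∩ K) = 0 := by
  have hcontent : hContent n (densityGauge μ d K) 1 Q = 0 :=
    le_antisymm ((le_iSup₂ (f := fun (δ : ℝ) (_ : 0 < δ) =>
      hContent n (densityGauge μ d K) δ Q) 1 one_pos).trans hQ.le) zero_le
  refine le_antisymm (le_trans ?_ hcontent.le) zero_le
  refine le_iInf fun c => le_iInf fun hc => le_iInf fun _ => ?_
  calc μ (Q ∩ K) ≤ μ (⋃ i, ball (c i).1 (c i).2 ∩ K) := by
        rw [← Set.iUnion_inter]
        exact measure_mono (Set.inter_subset_inter_left K hc)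
    _ ≤ ∑' i, μ (ball (c i).1 (c i).2 ∩ K) := measure_iUnion_le _
    _ ≤ _ := by
        refine ENNReal.tsum_le_tsum fun i => ?_
        split_ifs with hi
        · exact measure_ball_inter_le_densityGauge μ d K _ hi
        · simp [ball_eq_empty.2 (not_lt.1 hi)]

/-- If for every nondecreasing positive gauge `λ` on `(0,1]` with `λ(t)/t^{n-1} → 0`
the measure `μ` is carried by a Borel set of vanishing `H^λ`-measure, then `μ` is
carried by the set `P` where the `(n-1)`-upper density is positive, and hence `μ` is
concentrated on a set of `σ`-finite `H^{n-1}` measure. -/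
theorem concentrated_on_sigma_finite_set
    (n : ℕ) (hn : 2 ≤ n)
    (μ : Measure (EuclideanSpace ℝ (Fin n))) [IsFiniteMeasure μ]
    (h : ∀ lam : ℝ → ℝ, MonotoneOn lam (Set.Ioc (0 : ℝ) 1) →
      (∀ t ∈ Set.Ioc (0 : ℝ) 1, 0 < lam t) →
      Tendsto (fun t : ℝ => lam t / t ^ (n - 1)) (𝓝[>] 0) (𝓝 0) →
      ∃ Q₁ : Set (EuclideanSpace ℝ (Fin n)), MeasurableSet Q₁ ∧
        μ Q₁ᶜ = 0 ∧ hMeasure n lam Q₁ = 0) :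
    μ {x | 0 < limsup
        (fun t : ℝ => μ (ball x t) / ENNReal.ofReal (t ^ (n - 1))) (𝓝[>] 0)}ᶜ = 0 ∧
    ∃ S : ℕ → Set (EuclideanSpace ℝ (Fin n)),
      (∀ i, MeasurableSet (S i)) ∧
      (∀ i, μH[(n : ℝ) - 1] (S i) < ⊤) ∧
      μ (⋃ i, S i)ᶜ = 0 := by
  set N : Set (EuclideanSpace ℝ (Fin n)) := ⋂ m, ⋃ k, smallDensitySet μ (n - 1) m k
  have hN : μ N = 0 := by
    refine le_antisymm (le_of_forall_pos_le_add fun ε hε => ?_) zero_le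
    obtain ⟨κ, hκ⟩ := exists_measure_diff_iInter_smallDensitySet_le μ (n - 1) hε.ne'
    set K := ⋂ m, smallDensitySet μ (n - 1) m (κ m)
    obtain ⟨Q, -, hQc, hQ⟩ := h (densityGauge μ (n - 1) K) (monotoneOn_densityGauge μ _ K)
      (fun t ht => densityGauge_pos μ _ K ht.1)
      (tendsto_densityGauge_div_pow μ _ K κ fun m => Set.iInter_subset _ m)
    have hsub : N ⊆ (N \ K) ∪ (Qᶜ ∪ Q ∩ K) := by
      intro x hx
      by_cases hxK : x ∈ K
      · by_cases hxQ : x ∈ Q <;> simp [hxK, hxQ]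
      · exact Or.inl ⟨hx, hxK⟩
    calc μ N ≤ μ (N \ K) + (μ Qᶜ + μ (Q ∩ K)) :=
          (measure_mono hsub).trans ((measure_union_le _ _).trans
            (add_le_add_right (measure_union_le _ _) _))
      _ = μ (N \ K) := by
          rw [hQc, measure_inter_eq_zero_of_hMeasure_densityGauge μ _ hQ, add_zero, add_zero]
      _ ≤ 0 + ε := by rwa [zero_add]
  refine ⟨measure_mono_null (fun x hx => Set.mem_iInter.2 fun m =>
      mem_iUnion_smallDensitySet_of_limsup_eq_zero μ (n - 1) m ?_) hN,
    fun m => (⋃ k, smallDensitySet μ (n - 1) m k)ᶜ,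
    fun m => (measurableSet_iUnion_smallDensitySet μ (n - 1) m).compl, fun m => ?_, ?_⟩
  · simpa using hx
  · rw [← Nat.cast_pred (by lia)]
    exact hausdorffMeasure_compl_iUnion_smallDensitySet_lt_top μ (n - 1) m
  · rwa [Set.compl_iUnion, Set.iInter_congr fun m => compl_compl _]
end

section
/- Let n ≥ 2 and let μ be a locally finite Borel measure on ℝⁿ. Then the set P = {x ∈ ℝⁿ : limsup_{t→0⁺} μ(B(x,t))/t^{n−1} > 0} has σ-finite H^{n−1} measure, i.e. P = ⋃_{i=1}^{∞} P_i with H^{n−1}(P_i) < ∞ for each i. -/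
open MeasureTheory Metric Filter Topology
open scoped ENNReal

/-- If every point of `s` is the center of arbitrarily small balls `B(x,t)` contained in `U`
with `c t^d ≤ μ(B(x,t))`, then `H^d(s) ≤ 10^d c⁻¹ μ(U)`. -/
theorem hausdorffMeasure_le_of_frequently_le_measure_ball {X : Type*} [MetricSpace X]
    [TopologicalSpace.SeparableSpace X] [MeasurableSpace X] [BorelSpace X] (μ : Measure X) (d : ℕ)
    {s U : Set X} {c : ℝ≥0∞} (hc : c ≠ 0) (hc' : c ≠ ⊤)
    (hs : ∀ x ∈ s, ∃ᶠ t in 𝓝[>] (0 : ℝ), c * ENNReal.ofReal (t ^ d) ≤ μ (ball x t))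
    (hU : ∀ x ∈ s, ball x 1 ⊆ U) :
    μH[(d : ℝ)] s ≤ 10 ^ d * (c⁻¹ * μ U) := by
  let δ : ℕ → ℝ := fun m => 1 / (m + 1)
  have δ_pos : ∀ m, 0 < δ m := fun m => by positivity
  have δ_le : ∀ m, δ m ≤ 1 := fun m => by
    simp only [δ]
    rw [div_le_one (by positivity)]
    linarith [(Nat.cast_nonneg m : (0 : ℝ) ≤ m)]
  have hcover : ∀ m, ∃ u : Set (X × ℝ),
      (∀ p ∈ u, p.1 ∈ s ∧ 0 < p.2 ∧ p.2 ≤ δ m ∧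
        c * ENNReal.ofReal (p.2 ^ d) ≤ μ (ball p.1 p.2)) ∧
      u.PairwiseDisjoint (fun p => ball p.1 p.2) ∧ s ⊆ ⋃ p : u, ball p.1.1 (5 * p.1.2) := by
    intro m
    obtain ⟨u, hut, hdisj, hcov⟩ := Vitali.exists_disjoint_subfamily_covering_enlargement_ball
      {p : X × ℝ | p.1 ∈ s ∧ 0 < p.2 ∧ p.2 ≤ δ m ∧
        c * ENNReal.ofReal (p.2 ^ d) ≤ μ (ball p.1 p.2)}
      Prod.fst Prod.snd (δ m) (fun p hp => hp.2.2.1) 5 (by norm_num)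
    refine ⟨u, fun p hp => hut hp, hdisj, fun x hx => ?_⟩
    obtain ⟨r, hr, hr0, hrδ⟩ :=
      ((hs x hx).and_eventually (Ioc_mem_nhdsGT (δ_pos m))).exists
    obtain ⟨b, hb, hsub⟩ := hcov (x, r) ⟨hx, hr0, hrδ, hr⟩
    exact Set.mem_iUnion.2 ⟨⟨b, hb⟩, hsub (mem_ball_self hr0)⟩
  choose u hu hdisj hcov using hcover
  have hcount : ∀ m, Countable (u m) := fun m =>
    ((hdisj m).countable_of_isOpen (fun p _ => isOpen_ball)
      (fun p hp => ⟨p.1, mem_ball_self (hu m p hp).2.1⟩)).to_subtype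
  have hdiam : ∀ m (p : u m),
      ediam (ball p.1.1 (5 * p.1.2)) ≤ 10 * ENNReal.ofReal p.1.2 := by
    intro m p
    have h0 := (hu m p p.2).2.1
    rw [← eball_ofReal]
    refine ediam_eball_le.trans_eq ?_
    rw [ENNReal.ofReal_mul (by norm_num), ← mul_assoc]
    norm_num
  have hlim : Tendsto (fun m => 10 * ENNReal.ofReal (δ m)) atTop (𝓝 0) := by
    have h : Tendsto (fun m => ENNReal.ofReal (δ m)) atTop (𝓝 (ENNReal.ofReal 0)) :=
      ENNReal.tendsto_ofReal tendsto_one_div_add_atTop_nhds_zero_nat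
    simpa using ENNReal.Tendsto.const_mul (a := 10) h (Or.inr (by norm_num))
  refine (Measure.hausdorffMeasure_le_liminf_tsum (d : ℝ) s _ hlim
    (fun m (p : u m) => ball p.1.1 (5 * p.1.2))
    (Eventually.of_forall fun m p => (hdiam m p).trans ?_)
    (Eventually.of_forall hcov)).trans ?_
  · gcongr
    exact (hu m p p.2).2.2.1
  · refine (liminf_le_liminf (Eventually.of_forall fun m => ?_)).trans
      (liminf_const (10 ^ d * (c⁻¹ * μ U))).le
    calc ∑' p : u m, ediam (ball p.1.1 (5 * p.1.2)) ^ (d : ℝ)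
        ≤ ∑' p : u m, 10 ^ d * (c⁻¹ * μ (ball p.1.1 p.1.2)) := by
          refine ENNReal.tsum_le_tsum fun p => ?_
          obtain ⟨-, h0, -, hp⟩ := hu m p p.2
          rw [ENNReal.rpow_natCast]
          calc _ ≤ (10 * ENNReal.ofReal p.1.2) ^ d := by gcongr; exact hdiam m p
            _ = 10 ^ d * (c⁻¹ * (c * ENNReal.ofReal (p.1.2 ^ d))) := by
              rw [mul_pow, ENNReal.inv_mul_cancel_left hc hc', ENNReal.ofReal_pow h0.le]
            _ ≤ _ := by gcongr
      _ = 10 ^ d * (c⁻¹ * ∑' p : u m, μ (ball p.1.1 p.1.2)) := by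
          rw [ENNReal.tsum_mul_left, ENNReal.tsum_mul_left]
      _ ≤ 10 ^ d * (c⁻¹ * μ U) := by
          gcongr
          refine (tsum_meas_le_meas_iUnion_of_disjoint μ (fun p => measurableSet_ball)
            ((hdisj m).subtype _ _)).trans (measure_mono (Set.iUnion_subset fun p => ?_))
          obtain ⟨hps, -, hpδ, -⟩ := hu m p p.2
          exact (ball_subset_ball (hpδ.trans (δ_le m))).trans (hU _ hps)

/-- For a locally finite Borel measure `μ` on `ℝⁿ`, the set
`P = {x : limsup_{t→0⁺} μ(B(x,t))/t^{n-1} > 0}` has `σ`-finite `H^{n-1}` measure. -/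
theorem density_set_sigma_finite
    (n : ℕ) (hn : 2 ≤ n)
    (μ : Measure (EuclideanSpace ℝ (Fin n))) [IsLocallyFiniteMeasure μ] :
    ∃ P : ℕ → Set (EuclideanSpace ℝ (Fin n)),
      {x | 0 < limsup (fun t : ℝ => μ (ball x t) / ENNReal.ofReal (t ^ (n - 1)))
          (𝓝[>] 0)} = ⋃ i, P i ∧
      ∀ i, μH[(n : ℝ) - 1] (P i) < ⊤ := by
  refine ⟨fun k => {x | x ∈ ball 0 (k : ℝ) ∧ ((k : ℝ≥0∞) + 1)⁻¹ <
    limsup (fun t : ℝ => μ (ball x t) / ENNReal.ofReal (t ^ (n - 1))) (𝓝[>] 0)}, ?_, fun k => ?_⟩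
  · ext x
    simp only [Set.mem_ofPred_eq, Set.mem_iUnion]
    refine ⟨fun hx => ?_, fun ⟨k, _, hk⟩ => pos_of_gt hk⟩
    obtain ⟨a, ha⟩ := ENNReal.exists_inv_nat_lt hx.ne'
    obtain ⟨b, hb⟩ := exists_nat_gt ‖x‖
    refine ⟨max a b, ?_, lt_of_le_of_lt ?_ ha⟩
    · rw [mem_ball_zero_iff]
      exact hb.trans_le (by exact_mod_cast le_max_right a b)
    · rw [ENNReal.inv_le_inv]
      exact_mod_cast (le_max_left a b).trans (Nat.le_succ _)
  · rw [show (n : ℝ) - 1 = ((n - 1 : ℕ) : ℝ) by rw [Nat.cast_sub (by omega)]; simp]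
    refine (hausdorffMeasure_le_of_frequently_le_measure_ball μ (n - 1)
      (U := ball 0 (k + 1)) (c := ((k : ℝ≥0∞) + 1)⁻¹) (by simp) (by simp) ?_ ?_).trans_lt ?_
    · exact fun x hx => (frequently_lt_of_lt_limsup (by isBoundedDefault) hx.2).mono
        fun t ht => ENNReal.mul_le_of_le_div ht.le
    · intro x hx
      refine ball_subset_ball' ?_
      linarith [mem_ball.1 hx.1]
    · exact ENNReal.mul_lt_top (by simp)
        (ENNReal.mul_lt_top (by simp) measure_ball_lt_top)
end
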